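/- Let n ≥ 2 and suppose the cluster pattern with initial seed (B, (u_1,…,u_n)) is of type C_n. Then for every cluster (y_1,…,y_n) of the pattern, the denominator vectors den(y_1), …, den(y_n), taken with respect to the initial cluster (u_1,…,u_n), are linearly independent over ℚ; in particular they form a basis of ℚ^n. -/

import Mathlib

open MvPolynomial Matrix

noncomputable section

/-- The ambient field `ℚ(u_1, …, u_n)`. -/
abbrev CAField (n : ℕ) : Type := FractionRing (MvPolynomial (Fin n) ℚ)

/-- The initial cluster variables `u_i`. -/
def uVar (n : ℕ) (i : Fin n) : CAField n :=
  algebraMap (MvPolynomial (Fin n) ℚ) (CAField n) (X i)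

/-- Fomin–Zelevinsky matrix mutation in direction `k`. -/
def mutMat {n : ℕ} (k : Fin n) (B : Matrix (Fin n) (Fin n) ℤ) :
    Matrix (Fin n) (Fin n) ℤ := fun i j =>
  if i = k ∨ j = k then -B i j
  else B i j + (B i k).sign * max (B i k * B k j) 0

/-- Seed mutation in direction `k`: the matrix mutates by `mutMat` and the
`k`-th cluster variable `x_k` is replaced by
`(∏ x_i^{[B_ik]_+} + ∏ x_i^{[-B_ik]_+}) / x_k`. -/
def mutSeed {n : ℕ} (k : Fin n)
    (s : Matrix (Fin n) (Fin n) ℤ × (Fin n → CAField n)) :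
    Matrix (Fin n) (Fin n) ℤ × (Fin n → CAField n) :=
  (mutMat k s.1,
    Function.update s.2 k
      ((∏ i, s.2 i ^ (s.1 i k).toNat + ∏ i, s.2 i ^ (-(s.1 i k)).toNat) / s.2 k))

/-- The seeds of the cluster pattern with initial exchange matrix `B₀` and
initial cluster `(u_1, …, u_n)`: all seeds reachable from the initial seed
by finite sequences of mutations. -/
def IsSeed {n : ℕ} (B₀ : Matrix (Fin n) (Fin n) ℤ)
    (s : Matrix (Fin n) (Fin n) ℤ × (Fin n → CAField n)) : Prop :=
  Relation.ReflTransGen (fun a b => ∃ k, b = mutSeed k a) (B₀, uVar n) s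

/-- `B` is skew-symmetrizable: `D * B` is skew-symmetric for some diagonal `D`
with positive integer diagonal entries. -/
def SkewSymmetrizable {n : ℕ} (B : Matrix (Fin n) (Fin n) ℤ) : Prop :=
  ∃ d : Fin n → ℤ, (∀ i, 0 < d i) ∧
    (Matrix.diagonal d * B)ᵀ = -(Matrix.diagonal d * B)

/-- The Cartan counterpart `A(B)` of `B`. -/
def cartanCounterpart {n : ℕ} (B : Matrix (Fin n) (Fin n) ℤ) :
    Matrix (Fin n) (Fin n) ℤ := fun i j => if i = j then 2 else -|B i j|

/-- The Cartan matrix of type `C_n` (with rows and columns indexed by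
`0, …, n-1`): `2` on the diagonal, `-2` in position `(n-2, n-1)`, and `-1`
in the remaining positions `(i, i±1)`. -/
def cartanC (n : ℕ) : Matrix (Fin n) (Fin n) ℤ := fun i j =>
  if i = j then 2
  else if i.val + 2 = n ∧ j.val + 1 = n then -2
  else if i.val + 1 = j.val ∨ j.val + 1 = i.val then -1 else 0

/-- The cluster pattern with initial matrix `B₀` is of the finite type with
Cartan matrix `Cmat`: some seed of the pattern has exchange matrix whose
Cartan counterpart equals `Cmat` up to simultaneous permutation of rows and
columns. -/
def PatternOfType {n : ℕ} (Cmat B₀ : Matrix (Fin n) (Fin n) ℤ) : Prop :=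
  ∃ s, IsSeed B₀ s ∧ ∃ σ : Equiv.Perm (Fin n),
    ∀ i j, cartanCounterpart s.1 (σ i) (σ j) = Cmat i j

/-- `d` is the denominator vector of `y` with respect to the cluster `z`:
`y = f(z_1, …, z_n) / ∏ z_i^{d_i}` with `f` an integer polynomial not
divisible by any variable. -/
def IsDenomVec {n : ℕ} (z : Fin n → CAField n) (y : CAField n)
    (d : Fin n → ℤ) : Prop :=
  ∃ f : MvPolynomial (Fin n) ℤ, (∀ i, ¬ X i ∣ f) ∧
    y = MvPolynomial.aeval z f / ∏ i, z i ^ d i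


/-- `(x, y)` is a lift of the chord `t`, up to rotation by `M` and reversal. -/
def Orb (M : ℤ) (t : ℤ × ℤ) (x y : ℤ) : Prop :=
  ∃ k : ℤ, (x = t.1 + k * M ∧ y = t.2 + k * M) ∨
    (x = t.2 + k * M ∧ y = t.1 + 2 * M + k * M)

theorem orb_self (M : ℤ) (t : ℤ × ℤ) : Orb M t t.1 t.2 := ⟨0, by simp⟩

theorem orb_shift {M : ℤ} {t : ℤ × ℤ} {x y : ℤ} (h : Orb M t x y) (k : ℤ) :
    Orb M t (x + k * M) (y + k * M) := by
  obtain ⟨l, h⟩ := h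
  refine ⟨l + k, ?_⟩
  rcases h with ⟨h1, h2⟩ | ⟨h1, h2⟩
  · left; subst h1 h2; constructor <;> ring
  · right; subst h1 h2; constructor <;> ring

theorem orb_swap {M : ℤ} {t : ℤ × ℤ} {x y : ℤ} (h : Orb M t x y) :
    Orb M t y (x + 2 * M) := by
  obtain ⟨l, h⟩ := h
  rcases h with ⟨h1, h2⟩ | ⟨h1, h2⟩
  · refine ⟨l, Or.inr ?_⟩; subst h1 h2; constructor <;> ring
  · refine ⟨l + 2, Or.inl ?_⟩; subst h1 h2; constructor <;> ring

theorem orb_symm {M : ℤ} {t : ℤ × ℤ} {x y : ℤ} (h : Orb M t x y) :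
    Orb M (x, y) t.1 t.2 := by
  obtain ⟨l, h⟩ := h
  rcases h with ⟨h1, h2⟩ | ⟨h1, h2⟩
  · refine ⟨-l, Or.inl ?_⟩; subst h1 h2; constructor <;> simp only <;> ring
  · refine ⟨-l - 2, Or.inr ?_⟩; subst h1 h2; constructor <;> simp only <;> ring

theorem orb_trans {M : ℤ} {t : ℤ × ℤ} {x y z w : ℤ} (h : Orb M t x y)
    (h' : Orb M (x, y) z w) : Orb M t z w := by
  obtain ⟨l, h'⟩ := h'
  rcases h' with ⟨h1, h2⟩ | ⟨h1, h2⟩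
  · subst h1 h2; exact orb_shift h l
  · subst h1 h2; exact orb_shift (orb_swap h) l

theorem orb_rel {M : ℤ} {t : ℤ × ℤ} {x y z w : ℤ} (h : Orb M t x y)
    (h' : Orb M t z w) : Orb M (x, y) z w :=
  orb_trans (orb_symm h) h'

theorem orb_swap' {M : ℤ} {t : ℤ × ℤ} {x y : ℤ} (h : Orb M t y (x + 2 * M)) :
    Orb M t x y := by
  have := orb_shift (orb_swap h) (-2)
  convert this using 1 <;> ring

theorem orb_adj {M : ℤ} (hM : 0 < M) {t : ℤ × ℤ} {x y z : ℤ} (h : Orb M t x y)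
    (h' : Orb M t y z) (h1 : x < y) (h2 : y < z) (h3 : z < x + 2 * M) : False := by
  obtain ⟨k, ⟨e1, e2⟩ | ⟨e1, e2⟩⟩ := orb_rel h h'
  · simp only at e1 e2
    have a1 : 0 < k := by nlinarith
    have a2 : k < 2 := by nlinarith
    obtain rfl : k = 1 := by omega
    omega
  · simp only at e1 e2
    have : k * M = 0 := by linarith
    omega

theorem orb_len {M : ℤ} {t : ℤ × ℤ} {x y : ℤ} (h : Orb M t x y)
    (h1 : t.1 + 1 < t.2) (h2 : t.2 < t.1 + 2 * M - 1) : x + 1 < y ∧ y < x + 2 * M - 1 := by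
  obtain ⟨k, ⟨e1, e2⟩ | ⟨e1, e2⟩⟩ := h <;> subst e1 e2 <;> constructor <;> linarith

theorem orb_nc {M : ℤ} (hM : 0 < M) {a b c d : ℤ} (h : Orb M (a, b) c d)
    (h1 : a < c) (h2 : c < b) (h3 : b < d) (h4 : d < a + 2 * M) : False := by
  obtain ⟨k, ⟨e1, e2⟩ | ⟨e1, e2⟩⟩ := h
  · simp only at e1 e2
    have a1 : 0 < k := by nlinarith
    have a2 : k < 2 := by nlinarith
    obtain rfl : k = 1 := by omega
    omega
  · simp only at e1 e2
    have a1 : k < 0 := by nlinarith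
    have a2 : -2 < k := by nlinarith
    obtain rfl : k = -1 := by omega
    omega

/-- Sides: boundary edges or (lifts of) arcs of `T`. -/
def InT {n : ℕ} (M : ℤ) (T : Fin n → ℤ × ℤ) (a b : ℤ) : Prop :=
  b = a + 1 ∨ b = a + 2 * M - 1 ∨ ∃ i, Orb M (T i) a b

theorem InT.shift {n : ℕ} {M : ℤ} {T : Fin n → ℤ × ℤ} {a b : ℤ} (h : InT M T a b) (k : ℤ) :
    InT M T (a + k * M) (b + k * M) := by
  rcases h with h | h | ⟨i, h⟩
  · left; rw [h]; ring
  · right; left; rw [h]; ring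
  · right; right; exact ⟨i, orb_shift h k⟩

theorem InT.swap {n : ℕ} {M : ℤ} {T : Fin n → ℤ × ℤ} {a b : ℤ} (h : InT M T a b) :
    InT M T b (a + 2 * M) := by
  rcases h with h | h | ⟨i, h⟩
  · right; left; rw [h]; ring
  · left; rw [h]; ring
  · right; right; exact ⟨i, orb_swap h⟩

theorem InT.swap' {n : ℕ} {M : ℤ} {T : Fin n → ℤ × ℤ} {a b : ℤ} (h : InT M T b (a + 2 * M)) :
    InT M T a b := by
  have := h.swap.shift (-2)
  convert this using 1 <;> ring

/-- Centrally symmetric triangulations of the `2M`-gon, with labelled orbits of arcs. -/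
structure Tri {n : ℕ} (M : ℤ) (T : Fin n → ℤ × ℤ) : Prop where
  len : ∀ i, (T i).1 + 1 < (T i).2 ∧ (T i).2 < (T i).1 + 2 * M - 1
  inj : ∀ i j x y, Orb M (T i) x y → Orb M (T j) x y → i = j
  nc : ∀ a b c d, InT M T a b → InT M T c d → a < c → c < b → b < d → d < a + 2 * M → False
  third : ∀ i a b, Orb M (T i) a b → ∃ c, a < c ∧ c < b ∧ InT M T a c ∧ InT M T c b

/-- `p r q s` is a quadrilateral of `T` with diagonal `(p, q)` in the orbit of `T k`. -/
structure Quad {n : ℕ} (M : ℤ) (T : Fin n → ℤ × ℤ) (k : Fin n) (p r q s : ℤ) : Prop where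
  diag : Orb M (T k) p q
  pr : p < r
  rq : r < q
  qs : q < s
  sp : s < p + 2 * M
  ipr : InT M T p r
  irq : InT M T r q
  iqs : InT M T q s
  isp : InT M T s (p + 2 * M)

theorem Quad.shift {n : ℕ} {M : ℤ} {T : Fin n → ℤ × ℤ} {k : Fin n} {p r q s : ℤ}
    (h : Quad M T k p r q s) (l : ℤ) :
    Quad M T k (p + l * M) (r + l * M) (q + l * M) (s + l * M) := by
  obtain ⟨h0, h1, h2, h3, h4, h5, h6, h7, h8⟩ := h
  refine ⟨orb_shift h0 l, by linarith, by linarith, by linarith, by linarith,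
    h5.shift l, h6.shift l, h7.shift l, ?_⟩
  convert h8.shift l using 1; ring

theorem Quad.swap {n : ℕ} {M : ℤ} {T : Fin n → ℤ × ℤ} {k : Fin n} {p r q s : ℤ}
    (h : Quad M T k p r q s) :
    Quad M T k q s (p + 2 * M) (r + 2 * M) := by
  obtain ⟨h0, h1, h2, h3, h4, h5, h6, h7, h8⟩ := h
  refine ⟨orb_swap h0, by linarith, by linarith, by linarith, by linarith, h7, h8, ?_, ?_⟩
  · convert h5.shift 2 using 1
  · convert h6.shift 2 using 1

/-- Uniqueness of third vertices. -/
theorem Tri.third_unique {n : ℕ} {M : ℤ} {T : Fin n → ℤ × ℤ} (hT : Tri M T) {a b c c' : ℤ}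
    (hb : b < a + 2 * M)
    (h1 : a < c) (h2 : c < b) (h3 : InT M T a c) (h4 : InT M T c b)
    (h1' : a < c') (h2' : c' < b) (h3' : InT M T a c') (h4' : InT M T c' b) : c = c' := by
  rcases lt_trichotomy c c' with h | h | h
  · exact (hT.nc _ _ _ _ h3' h4 h1 h h2' hb).elim
  · exact h
  · exact (hT.nc _ _ _ _ h3 h4' h1' h h2 hb).elim

theorem Tri.orb_lt {n : ℕ} {M : ℤ} {T : Fin n → ℤ × ℤ} (hT : Tri M T) {i : Fin n} {x y : ℤ}
    (h : Orb M (T i) x y) : x + 1 < y ∧ y < x + 2 * M - 1 :=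
  orb_len h (hT.len i).1 (hT.len i).2

theorem Tri.exists_quad {n : ℕ} {M : ℤ} {T : Fin n → ℤ × ℤ} (hT : Tri M T) {i : Fin n} {x y : ℤ}
    (h : Orb M (T i) x y) : ∃ r s, Quad M T i x r y s := by
  obtain ⟨r, h1, h2, h3, h4⟩ := hT.third i _ _ h
  obtain ⟨s, h1', h2', h3', h4'⟩ := hT.third i _ _ (orb_swap h)
  exact ⟨r, s, h, h1, h2, h1', h2', h3, h4, h3', h4'⟩

theorem Quad.lt {n : ℕ} {M : ℤ} {T : Fin n → ℤ × ℤ} {k : Fin n} {p r q s : ℤ}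
    (h : Quad M T k p r q s) : q < p + 2 * M := by
  have := h.qs; have := h.sp; linarith

theorem Quad.unique {n : ℕ} {M : ℤ} {T : Fin n → ℤ × ℤ} (hT : Tri M T) {k : Fin n}
    {p r q s r' s' : ℤ}
    (h : Quad M T k p r q s) (h' : Quad M T k p r' q s') : r = r' ∧ s = s' := by
  constructor
  · exact hT.third_unique h.lt h.pr h.rq h.ipr h.irq h'.pr h'.rq h'.ipr h'.irq
  · refine hT.third_unique (a := q) (b := p + 2 * M) ?_ h.qs h.sp h.iqs h.isp h'.qs h'.sp h'.iqs h'.isp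
    have := h.pr; have := h.rq; linarith

/-- any two quads of the same orbit are related, so the opposite diagonals are too. -/
theorem Quad.opp {n : ℕ} {M : ℤ} {T : Fin n → ℤ × ℤ} (hT : Tri M T) {k : Fin n}
    {p r q s p' r' q' s' : ℤ}
    (h : Quad M T k p r q s) (h' : Quad M T k p' r' q' s') : Orb M (r, s) r' s' := by
  obtain ⟨l, ⟨e1, e2⟩ | ⟨e1, e2⟩⟩ := orb_rel h.diag h'.diag
  · simp only at e1 e2
    subst e1 e2
    obtain ⟨rfl, rfl⟩ := h'.unique hT (h.shift l)
    exact orb_shift (orb_self M (r, s)) l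
  · simp only at e1 e2
    subst e1 e2
    obtain ⟨rfl, rfl⟩ := h'.unique hT (h.swap.shift l)
    exact orb_shift (orb_swap (orb_self M (r, s))) l

/-- The flipped triangulation. -/
def flipT {n : ℕ} (T : Fin n → ℤ × ℤ) (k : Fin n) (r s : ℤ) : Fin n → ℤ × ℤ :=
  Function.update T k (r, s)

theorem Quad.not_sides {n : ℕ} {M : ℤ} (hM : 0 < M) {T : Fin n → ℤ × ℤ} {k : Fin n}
    {p r q s : ℤ} (h : Quad M T k p r q s) :
    ¬ Orb M (T k) p r ∧ ¬ Orb M (T k) r q ∧ ¬ Orb M (T k) q s ∧ ¬ Orb M (T k) s (p + 2 * M) := by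
  obtain ⟨h0, h1, h2, h3, h4, -, -, -, -⟩ := h
  refine ⟨fun h => ?_, fun h => ?_, fun h => ?_, fun h => ?_⟩
  · exact orb_adj hM (orb_swap h0) (orb_shift h 2) (by linarith) (by linarith) (by linarith)
  · exact orb_adj hM h (orb_swap h0) (by linarith) (by linarith) (by linarith)
  · exact orb_adj hM h0 h (by linarith) (by linarith) (by linarith)
  · exact orb_adj hM h (orb_shift h0 2) (by linarith) (by linarith) (by linarith)

theorem Quad.opp_exists {n : ℕ} {M : ℤ} {T : Fin n → ℤ × ℤ} {k : Fin n}
    {p r q s a b : ℤ} (h : Quad M T k p r q s) (ho : Orb M (r, s) a b) :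
    ∃ P Q, Quad M T k P a Q b := by
  obtain ⟨l, ⟨e1, e2⟩ | ⟨e1, e2⟩⟩ := ho
  · simp only at e1 e2; subst e1 e2; exact ⟨_, _, h.shift l⟩
  · simp only at e1 e2; subst e1 e2; exact ⟨_, _, h.swap.shift l⟩

theorem Quad.not_in_opp {n : ℕ} {M : ℤ} {T : Fin n → ℤ × ℤ} (hT : Tri M T) {k : Fin n}
    {p r q s : ℤ} (h : Quad M T k p r q s) : ¬ InT M T r s := fun hi =>
  hT.nc p q r s (Or.inr (Or.inr ⟨k, h.diag⟩)) hi h.pr h.rq h.qs h.sp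

/-- Chords of `T` other than the diagonal do not cross the opposite diagonal. -/
theorem Quad.nc_opp {n : ℕ} {M : ℤ} {T : Fin n → ℤ × ℤ} (hT : Tri M T) {k : Fin n}
    {p r q s a b : ℤ} (h : Quad M T k p r q s) (hi : InT M T a b) (hk : ¬ Orb M (T k) a b)
    (h1 : a < r) (h2 : r < b) (h3 : b < s) (h4 : s < a + 2 * M) : False := by
  obtain ⟨g0, g1, g2, g3, g4, g5, g6, g7, g8⟩ := h
  rcases lt_trichotomy b q with hb | hb | hb
  · exact hT.nc _ _ _ _ hi g6 h1 h2 hb (by linarith)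
  · subst hb
    rcases lt_trichotomy a p with ha | ha | ha
    · have g8' : InT M T (s - 2 * M) p := by
        convert g8.shift (-2) using 1 <;> ring
      exact hT.nc _ _ _ _ g8' hi (by linarith) ha (by linarith) (by linarith)
    · subst ha; exact hk g0
    · exact hT.nc _ _ _ _ g5 hi ha h1 h2 (by linarith)
  · exact hT.nc _ _ _ _ hi g7 (by linarith) hb h3 (by linarith)

theorem Quad.nc_opp' {n : ℕ} {M : ℤ} {T : Fin n → ℤ × ℤ} (hT : Tri M T) {k : Fin n}
    {p r q s a b : ℤ} (h : Quad M T k p r q s) (hi : InT M T a b) (hk : ¬ Orb M (T k) a b)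
    (h1 : r < a) (h2 : a < s) (h3 : s < b) (h4 : b < r + 2 * M) : False :=
  h.swap.nc_opp hT hi hk h2 h3 h4 (by linarith)

/-- Analysis of the triangle at a side. -/
theorem Tri.half_cases {n : ℕ} {M : ℤ} {T : Fin n → ℤ × ℤ} (hT : Tri M T) (k : Fin n)
    {a b c : ℤ} (hb : b < a + 2 * M)
    (hab : InT M T a b) (h1 : a < c) (h2 : c < b) (h3 : InT M T a c) (h4 : InT M T c b) :
    (¬ Orb M (T k) a c ∧ ¬ Orb M (T k) c b) ∨ (∃ R, Quad M T k a R c b) ∨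
      (∃ R, Quad M T k (b - 2 * M) a c R) := by
  by_cases ho : Orb M (T k) a c
  · obtain ⟨R, g1, g2, g3, g4⟩ := hT.third k _ _ ho
    exact Or.inr (Or.inl ⟨R, ho, g1, g2, h2, hb, g3, g4, h4, hab.swap⟩)
  by_cases ho' : Orb M (T k) c b
  · obtain ⟨R, g1, g2, g3, g4⟩ := hT.third k _ _ ho'
    refine Or.inr (Or.inr ⟨R, orb_swap' ?_, by linarith, h1, g1, by linarith, InT.swap' ?_, h3,
      g3, ?_⟩)
    · convert ho' using 1; ring
    · convert hab using 1; ring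
    · convert g4 using 1; ring
  · exact Or.inl ⟨ho, ho'⟩

section flip
variable {n : ℕ} {M : ℤ} {T : Fin n → ℤ × ℤ} {k : Fin n} {p r q s : ℤ}

theorem flip_ne {i : Fin n} (hi : i ≠ k) : flipT T k r s i = T i := by
  simp [flipT, hi]

theorem flip_k : flipT T k r s k = (r, s) := by
  simp [flipT]

theorem flip_in {a b : ℤ} (h : InT M T a b) (hk : ¬ Orb M (T k) a b) :
    InT M (flipT T k r s) a b := by
  rcases h with h | h | ⟨i, h⟩
  · exact Or.inl h
  · exact Or.inr (Or.inl h)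
  · have : i ≠ k := by rintro rfl; exact hk h
    exact Or.inr (Or.inr ⟨i, by rwa [flip_ne this]⟩)

theorem in_flip (hT : Tri M T) {a b : ℤ} (h : InT M (flipT T k r s) a b) :
    (InT M T a b ∧ ¬ Orb M (T k) a b) ∨ Orb M (r, s) a b := by
  by_cases ho : Orb M (r, s) a b
  · exact Or.inr ho
  left
  rcases h with h | h | ⟨i, h⟩
  · refine ⟨Or.inl h, fun h' => ?_⟩
    have := hT.orb_lt h'
    linarith
  · refine ⟨Or.inr (Or.inl h), fun h' => ?_⟩
    have := hT.orb_lt h'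
    linarith
  · by_cases hi : i = k
    · subst hi; rw [flip_k] at h; exact (ho h).elim
    · rw [flip_ne hi] at h
      exact ⟨Or.inr (Or.inr ⟨i, h⟩), fun h' => hi (hT.inj _ _ _ _ h h')⟩

theorem Quad.sides_flip (hM : 0 < M) {p' r' q' s' r s : ℤ} (h : Quad M T k p' r' q' s') :
    InT M (flipT T k r s) p' r' ∧ InT M (flipT T k r s) r' q' ∧
    InT M (flipT T k r s) q' s' ∧ InT M (flipT T k r s) s' (p' + 2 * M) := by
  obtain ⟨h1, h2, h3, h4⟩ := h.not_sides hM
  exact ⟨flip_in h.ipr h1, flip_in h.irq h2, flip_in h.iqs h3, flip_in h.isp h4⟩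

/-- The flipped quadrilateral. -/
theorem Quad.flip (hM : 0 < M) (hT : Tri M T) (h : Quad M T k p r q s) {p' r' q' s' : ℤ}
    (h' : Quad M T k p' r' q' s') :
    Quad M (flipT T k r s) k r' q' s' (p' + 2 * M) := by
  obtain ⟨g1, g2, g3, g4⟩ := h'.sides_flip hM (r := r) (s := s)
  refine ⟨?_, h'.rq, h'.qs, h'.sp, by have := h'.pr; linarith, g2, g3, g4, g1.shift 2⟩
  rw [flip_k]; exact h.opp hT h'

theorem Tri.flip (hM : 0 < M) (hT : Tri M T) (h : Quad M T k p r q s) :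
    Tri M (flipT T k r s) := by
  have key : ∀ i, ∀ a b, i ≠ k → Orb M (T i) a b → ¬ Orb M (r, s) a b := by
    intro i a b hi h1 h2
    have h3 : Orb M (T i) r s := orb_trans h1 (orb_symm h2)
    exact h.not_in_opp hT (Or.inr (Or.inr ⟨i, h3⟩))
  constructor
  · intro i
    by_cases hi : i = k
    · subst hi; rw [flip_k]
      have := h.pr; have := h.rq; have := h.qs; have := h.sp
      simp only; constructor <;> linarith
    · rw [flip_ne hi]; exact hT.len i
  · intro i j x y h1 h2
    by_cases hi : i = k <;> by_cases hj : j = k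
    · rw [hi, hj]
    · subst hi; rw [flip_k] at h1; rw [flip_ne hj] at h2
      exact (key _ _ _ hj h2 h1).elim
    · subst hj; rw [flip_k] at h2; rw [flip_ne hi] at h1
      exact (key _ _ _ hi h1 h2).elim
    · rw [flip_ne hi] at h1; rw [flip_ne hj] at h2; exact hT.inj _ _ _ _ h1 h2
  · intro a b c d hab hcd h1 h2 h3 h4
    rcases in_flip hT hab with ⟨h5, h6⟩ | h5 <;> rcases in_flip hT hcd with ⟨h7, h8⟩ | h7
    · exact hT.nc _ _ _ _ h5 h7 h1 h2 h3 h4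
    · obtain ⟨P, Q, hq⟩ := h.opp_exists h7
      exact hq.nc_opp hT h5 h6 h1 h2 h3 h4
    · obtain ⟨P, Q, hq⟩ := h.opp_exists h5
      exact hq.nc_opp' hT h7 h8 h1 h2 h3 h4
    · exact orb_nc hM (orb_rel h5 h7) h1 h2 h3 h4
  · intro i a b hab
    by_cases hi : i = k
    · subst hi; rw [flip_k] at hab
      obtain ⟨P, Q, hq⟩ := h.opp_exists hab
      have := h.flip hM hT hq
      exact ⟨Q, this.pr, this.rq, this.ipr, this.irq⟩
    · rw [flip_ne hi] at hab
      obtain ⟨c, g1, g2, g3, g4⟩ := hT.third i _ _ hab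
      have hlt := hT.orb_lt hab
      rcases hT.half_cases k (by linarith) (Or.inr (Or.inr ⟨i, hab⟩)) g1 g2 g3 g4 with
        ⟨g5, g6⟩ | ⟨R, hq⟩ | ⟨R, hq⟩
      · exact ⟨c, g1, g2, flip_in g3 g5, flip_in g4 g6⟩
      · have := h.flip hM hT hq
        refine ⟨R, hq.pr, by linarith [hq.rq], ?_, Or.inr (Or.inr ⟨k, this.diag⟩)⟩
        exact (hq.sides_flip hM).1
      · have := h.flip hM hT hq
        refine ⟨R, by linarith [hq.qs], by linarith [hq.sp], Or.inr (Or.inr ⟨k, this.diag⟩), ?_⟩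
        have := (hq.sides_flip hM (r := r) (s := s)).2.2.2
        convert this using 1; ring

end flip

open Classical in
/-- Indicator of the orbit of `T i`. -/
def eT {n : ℕ} (M : ℤ) (T : Fin n → ℤ × ℤ) (i : Fin n) (x y : ℤ) : ℤ :=
  if Orb M (T i) x y then 1 else 0

theorem eT_pos {n : ℕ} {M : ℤ} {T : Fin n → ℤ × ℤ} {i : Fin n} {x y : ℤ}
    (h : Orb M (T i) x y) : eT M T i x y = 1 := by simp [eT, h]

theorem eT_neg {n : ℕ} {M : ℤ} {T : Fin n → ℤ × ℤ} {i : Fin n} {x y : ℤ}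
    (h : ¬ Orb M (T i) x y) : eT M T i x y = 0 := by simp [eT, h]

theorem eT_shift {n : ℕ} (M : ℤ) (T : Fin n → ℤ × ℤ) (i : Fin n) (x y k : ℤ) :
    eT M T i (x + k * M) (y + k * M) = eT M T i x y := by
  have : Orb M (T i) (x + k * M) (y + k * M) ↔ Orb M (T i) x y := by
    refine ⟨fun h => ?_, fun h => orb_shift h k⟩
    convert orb_shift h (-k) using 1 <;> ring
  unfold eT; split_ifs <;> simp_all

theorem eT_swap {n : ℕ} (M : ℤ) (T : Fin n → ℤ × ℤ) (i : Fin n) (x y : ℤ) :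
    eT M T i y (x + 2 * M) = eT M T i x y := by
  have : Orb M (T i) y (x + 2 * M) ↔ Orb M (T i) x y := ⟨orb_swap', orb_swap⟩
  unfold eT; split_ifs <;> simp_all

theorem eT_flip_ne {n : ℕ} {M : ℤ} {T : Fin n → ℤ × ℤ} {k : Fin n} {r s : ℤ} {i : Fin n}
    (hi : i ≠ k) (x y : ℤ) : eT M (flipT T k r s) i x y = eT M T i x y := by
  unfold eT; rw [flip_ne hi]

/-- The column of the exchange matrix attached to a quadrilateral. -/
def colT {n : ℕ} (M : ℤ) (T : Fin n → ℤ × ℤ) (i : Fin n) (p r q s : ℤ) : ℤ :=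
  eT M T i p r + eT M T i q s - eT M T i r q - eT M T i s (p + 2 * M)

def Realizes {n : ℕ} (M : ℤ) (T : Fin n → ℤ × ℤ) (B : Matrix (Fin n) (Fin n) ℤ) : Prop :=
  ∀ j p r q s, Quad M T j p r q s → ∀ i, B i j = colT M T i p r q s

theorem realizes_of_base {n : ℕ} {M : ℤ} {T : Fin n → ℤ × ℤ} (hT : Tri M T)
    {B : Matrix (Fin n) (Fin n) ℤ}
    (h : ∀ j, ∃ p r q s, Quad M T j p r q s ∧ ∀ i, B i j = colT M T i p r q s) :
    Realizes M T B := by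
  intro j p' r' q' s' hq' i
  obtain ⟨p, r, q, s, hq, hB⟩ := h j
  rw [hB i]
  obtain ⟨l, ⟨e1, e2⟩ | ⟨e1, e2⟩⟩ := orb_rel hq.diag hq'.diag
  · simp only at e1 e2
    subst e1 e2
    obtain ⟨rfl, rfl⟩ := hq'.unique hT (hq.shift l)
    unfold colT
    rw [show p + l * M + 2 * M = p + 2 * M + l * M by ring]
    simp only [eT_shift]
  · simp only at e1 e2
    subst e1 e2
    obtain ⟨rfl, rfl⟩ := hq'.unique hT (hq.swap.shift l)
    unfold colT
    rw [show q + l * M + 2 * M = q + 2 * M + l * M by ring]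
    simp only [eT_shift]
    ring

theorem eT_01 {n : ℕ} (M : ℤ) (T : Fin n → ℤ × ℤ) (i : Fin n) (x y : ℤ) :
    eT M T i x y = 0 ∨ eT M T i x y = 1 := by
  unfold eT; split_ifs <;> simp

theorem eT_adj {n : ℕ} {M : ℤ} (hM : 0 < M) (T : Fin n → ℤ × ℤ) (i : Fin n) {x y z : ℤ}
    (h1 : x < y) (h2 : y < z) (h3 : z < x + 2 * M) :
    eT M T i x y = 0 ∨ eT M T i y z = 0 := by
  by_cases h : Orb M (T i) x y
  · right; exact eT_neg fun h' => orb_adj hM h h' h1 h2 h3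
  · left; exact eT_neg h

theorem col_parts {n : ℕ} {M : ℤ} (hM : 0 < M) (T : Fin n → ℤ × ℤ) (i : Fin n)
    {p r q s : ℤ} (h1 : p < r) (h2 : r < q) (h3 : q < s) (h4 : s < p + 2 * M) :
    max (colT M T i p r q s) 0 = eT M T i p r + eT M T i q s ∧
    max (-colT M T i p r q s) 0 = eT M T i r q + eT M T i s (p + 2 * M) := by
  have a1 := eT_adj hM T i h1 h2 (by linarith)
  have a2 := eT_adj hM T i (x := s) (y := p + 2 * M) (z := r + 2 * M) (by linarith) (by linarith)
    (by linarith)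
  rw [eT_shift] at a2
  have a3 := eT_adj hM T i h2 h3 (by linarith)
  have a4 := eT_adj hM T i h3 h4 (by linarith)
  have b1 := eT_01 M T i p r
  have b2 := eT_01 M T i q s
  have b3 := eT_01 M T i r q
  have b4 := eT_01 M T i s (p + 2 * M)
  unfold colT
  generalize eT M T i p r = x1 at *
  generalize eT M T i q s = x2 at *
  generalize eT M T i r q = x3 at *
  generalize eT M T i s (p + 2 * M) = x4 at *
  omega

theorem mut_formula (x y : ℤ) : x.sign * max (x * y) 0 =
    max y 0 * max x 0 - max (-y) 0 * max (-x) 0 := by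
  rcases lt_trichotomy x 0 with hx | hx | hx
  · rw [Int.sign_eq_neg_one_of_neg hx, max_eq_right hx.le, max_eq_left (by linarith : 0 ≤ -x)]
    rcases le_total y 0 with hy | hy
    · rw [max_eq_left (by nlinarith), max_eq_left (by linarith : 0 ≤ -y)]; ring
    · rw [max_eq_right (by nlinarith), max_eq_right (by linarith : -y ≤ 0)]; ring
  · subst hx; simp
  · rw [Int.sign_eq_one_of_pos hx, max_eq_left hx.le, max_eq_right (by linarith : -x ≤ 0)]
    rcases le_total y 0 with hy | hy
    · rw [max_eq_right (by nlinarith), max_eq_right hy]; ring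
    · rw [max_eq_left (by nlinarith), max_eq_left hy]; ring

theorem half_flip {n : ℕ} {M : ℤ} (hM : 0 < M) {T : Fin n → ℤ × ℤ} (hT : Tri M T) {k : Fin n}
    {p r q s : ℤ} (h : Quad M T k p r q s) {B : Matrix (Fin n) (Fin n) ℤ} (hB : Realizes M T B)
    {a b c : ℤ} (hb : b < a + 2 * M)
    (hab : InT M T a b) (h1 : a < c) (h2 : c < b) (h3 : InT M T a c) (h4 : InT M T c b) :
    ∃ c', a < c' ∧ c' < b ∧ InT M (flipT T k r s) a c' ∧ InT M (flipT T k r s) c' b ∧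
      (eT M (flipT T k r s) k a c' - eT M (flipT T k r s) k c' b =
        - (eT M T k a c - eT M T k c b)) ∧
      ∀ i, i ≠ k → eT M (flipT T k r s) i a c' - eT M (flipT T k r s) i c' b =
        eT M T i a c - eT M T i c b + max (eT M T k a c - eT M T k c b) 0 * max (B i k) 0
          - max (-(eT M T k a c - eT M T k c b)) 0 * max (-B i k) 0 := by
  have hT' := hT.flip hM h
  rcases hT.half_cases k hb hab h1 h2 h3 h4 with ⟨g5, g6⟩ | ⟨R, hq⟩ | ⟨R, hq⟩
  · refine ⟨c, h1, h2, flip_in h3 g5, flip_in h4 g6, ?_, ?_⟩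
    · rw [eT_neg g5, eT_neg g6]
      have : ∀ x y, InT M T x y → eT M (flipT T k r s) k x y = 0 := by
        intro x y hi
        refine eT_neg fun ho => ?_
        rw [flip_k] at ho
        obtain ⟨P, Q, hq⟩ := h.opp_exists ho
        exact hq.not_in_opp hT hi
      rw [this _ _ h3, this _ _ h4]; ring
    · intro i hi
      rw [eT_flip_ne hi, eT_flip_ne hi, eT_neg g5, eT_neg g6]
      simp
  · have hf := h.flip hM hT hq
    obtain ⟨n1, n2, n3, n4⟩ := hq.not_sides hM
    obtain ⟨m1, m2, m3, m4⟩ := hf.not_sides hM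
    refine ⟨R, hq.pr, by linarith [hq.rq], (hq.sides_flip hM).1,
      Or.inr (Or.inr ⟨k, hf.diag⟩), ?_, ?_⟩
    · have m4' : ¬ Orb M (flipT T k r s k) a R := by
        intro h; exact m4 (orb_shift h 2)
      rw [eT_pos hq.diag, eT_neg n3, eT_neg m4', eT_pos hf.diag]; ring
    · intro i hi
      obtain ⟨c1, c2⟩ := col_parts hM T i hq.pr hq.rq hq.qs hq.sp
      rw [← hB _ _ _ _ _ hq] at c1 c2
      rw [eT_flip_ne hi, eT_flip_ne hi, eT_pos hq.diag, eT_neg n3, c1]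
      have : eT M T i R b = 0 :=
        eT_neg fun ho => hq.not_in_opp hT (Or.inr (Or.inr ⟨i, ho⟩))
      have : eT M T i a c = 0 :=
        eT_neg fun ho => hi (hT.inj _ _ _ _ ho hq.diag)
      simp [*]
      try ring
  · have hf := h.flip hM hT hq
    obtain ⟨n1, n2, n3, n4⟩ := hq.not_sides hM
    obtain ⟨m1, m2, m3, m4⟩ := hf.not_sides hM
    have hd : Orb M (T k) c b := by
      have := orb_swap hq.diag
      convert this using 1; ring
    have e2 : b - 2 * M + 2 * M = b := by ring
    have s4 := (hq.sides_flip hM (r := r) (s := s)).2.2.2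
    rw [e2] at m3 s4 n4
    refine ⟨R, by linarith [hq.qs], by linarith [hq.sp],
      Or.inr (Or.inr ⟨k, hf.diag⟩), s4, ?_, ?_⟩
    · rw [eT_pos hd, eT_neg n2, eT_neg m3, eT_pos hf.diag]; ring
    · intro i hi
      obtain ⟨c1, c2⟩ := col_parts hM T i hq.pr hq.rq hq.qs hq.sp
      rw [← hB _ _ _ _ _ hq] at c1 c2
      rw [e2] at c2
      rw [eT_flip_ne hi, eT_flip_ne hi, eT_pos hd, eT_neg n2, c2]
      have : eT M T i a R = 0 :=
        eT_neg fun ho => hq.not_in_opp hT (Or.inr (Or.inr ⟨i, ho⟩))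
      have : eT M T i c b = 0 :=
        eT_neg fun ho => hi (hT.inj _ _ _ _ ho hd)
      simp [*]
      try ring

theorem Realizes.flip {n : ℕ} {M : ℤ} (hM : 0 < M) {T : Fin n → ℤ × ℤ} (hT : Tri M T) {k : Fin n}
    {p r q s : ℤ} (h : Quad M T k p r q s) {B : Matrix (Fin n) (Fin n) ℤ} (hB : Realizes M T B) :
    Realizes M (flipT T k r s) (mutMat k B) := by
  apply realizes_of_base (hT.flip hM h)
  intro j
  by_cases hj : j = k
  · subst hj
    have hf := h.flip hM hT h
    refine ⟨_, _, _, _, hf, fun i => ?_⟩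
    simp only [mutMat, or_true, if_true]
    rw [hB _ _ _ _ _ h]
    unfold colT
    rw [eT_shift]
    by_cases hi : i = j
    · subst hi
      obtain ⟨n1, n2, n3, n4⟩ := h.not_sides hM
      obtain ⟨m1, m2, m3, m4⟩ := hf.not_sides hM
      have m4' : ¬ Orb M (flipT T i r s i) p r := by
        intro h; exact m4 (orb_shift h 2)
      rw [eT_neg n1, eT_neg n2, eT_neg n3, eT_neg n4, eT_neg m1, eT_neg m2, eT_neg m3, eT_neg m4']
      ring
    · simp only [eT_flip_ne hi]; ring
  · obtain ⟨c, d, hq⟩ := hT.exists_quad (orb_self M (T j))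
    set a := (T j).1
    set b := (T j).2
    have hin : InT M T a b := Or.inr (Or.inr ⟨j, hq.diag⟩)
    obtain ⟨c', g1, g2, g3, g4, g5, g6⟩ := half_flip hM hT h hB hq.lt hin hq.pr hq.rq hq.ipr hq.irq
    obtain ⟨d', f1, f2, f3, f4, f5, f6⟩ := half_flip hM hT h hB
      (by linarith [hq.pr, hq.rq]) hin.swap hq.qs hq.sp hq.iqs hq.isp
    refine ⟨a, c', b, d', ⟨?_, g1, g2, f1, f2, g3, g4, f3, f4⟩, fun i => ?_⟩
    · rw [flip_ne hj]; exact hq.diag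
    by_cases hi : i = k
    · subst hi
      simp only [mutMat, true_or, if_true]
      rw [hB _ _ _ _ _ hq]
      unfold colT
      linarith
    · simp only [mutMat, hi, hj, or_self, if_false]
      rw [mut_formula, hB _ _ _ _ _ hq i, hB _ _ _ _ _ hq k]
      have G := g6 i hi
      have F := f6 i hi
      have a1 := eT_adj hM T k hq.rq hq.qs (by linarith [hq.sp, hq.pr])
      have a2 := eT_adj hM T k (x := d) (y := a + 2 * M) (z := c + 2 * M) hq.sp
        (by linarith [hq.pr]) (by linarith [hq.rq, hq.qs])
      rw [eT_shift] at a2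
      have b1 := eT_01 M T k a c
      have b2 := eT_01 M T k b d
      have b3 := eT_01 M T k c b
      have b4 := eT_01 M T k d (a + 2 * M)
      have c1 := eT_adj hM T k hq.pr hq.rq (by linarith [hq.sp, hq.qs])
      have c2 := eT_adj hM T k hq.qs hq.sp (by linarith [hq.pr, hq.rq])
      unfold colT at *
      have P : max (eT M T k a c + eT M T k b d - eT M T k c b - eT M T k d (a + 2 * M)) 0 =
        max (eT M T k a c - eT M T k c b) 0 + max (eT M T k b d - eT M T k d (a + 2 * M)) 0 := by
        clear G F g6 f6 g5 f5
        generalize eT M T k a c = x1 at *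
        generalize eT M T k b d = x2 at *
        generalize eT M T k c b = x3 at *
        generalize eT M T k d (a + 2 * M) = x4 at *
        omega
      have N : max (-(eT M T k a c + eT M T k b d - eT M T k c b - eT M T k d (a + 2 * M))) 0 =
        max (-(eT M T k a c - eT M T k c b)) 0
          + max (-(eT M T k b d - eT M T k d (a + 2 * M))) 0 := by
        clear G F g6 f6 g5 f5 P
        generalize eT M T k a c = x1 at *
        generalize eT M T k b d = x2 at *
        generalize eT M T k c b = x3 at *
        generalize eT M T k d (a + 2 * M) = x4 at *
        omega
      have K : ∀ z w : ℤ, eT M (flipT T k r s) i a c' + z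
        - eT M (flipT T k r s) i c' b - w = (eT M (flipT T k r s) i a c'
          - eT M (flipT T k r s) i c' b) + (z - w) := by intros; ring
      rw [P, N, K, G, F]
      ring

/-- Signed crossing number of two chords of a linearly ordered set of vertices
(`-1` if the chords are equal). -/
def cl {α : Type} [LinearOrder α] (c d x y : α) : ℤ :=
  if (c = x ∧ d = y) ∨ (c = y ∧ d = x) then -1
  else if (x < c ∧ c < y ∧ (d < x ∨ y < d)) ∨ (x < d ∧ d < y ∧ (c < x ∨ y < c)) then 1 else 0

theorem cl_symm {α : Type} [LinearOrder α] (c d x y : α) : cl c d x y = cl d c x y := by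
  unfold cl
  congr 1
  · rw [or_comm, and_comm, and_comm (a := c = x)]
  · congr 1
    rw [or_comm]

theorem oct_single : ∀ a b : Fin 8, cl a b 0 4 + cl a b 2 6 =
    max (cl a b 0 2 + cl a b 4 6) (cl a b 2 4 + cl a b 0 6) := by decide

/-- noncrossing of octagon types together with disjointness of endpoints -/
def compat8 (a b a' b' : Fin 8) : Bool :=
  !(decide (min a b < min a' b' ∧ min a' b' < max a b ∧ max a b < max a' b')) &&
  !(decide (min a' b' < min a b ∧ min a b < max a' b' ∧ max a' b' < max a b)) &&
  !(decide ((a = a' ∨ a = b') ∧ a.val % 2 = 0)) && !(decide ((b = a' ∨ b = b') ∧ b.val % 2 = 0))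

def sg8 (a b : Fin 8) : ℤ := cl a b 0 2 + cl a b 4 6 - (cl a b 2 4 + cl a b 0 6)

set_option maxRecDepth 100000 in
set_option maxHeartbeats 4000000 in
theorem oct_coherent : ∀ a b : Fin 8, 0 < sg8 a b → ∀ a' b' : Fin 8, sg8 a' b' < 0 →
    compat8 a b a' b' = false := by decide

theorem octF (W : Fin 8 → Fin 8 → ℚ) (hlow : ∀ a b, b < a → W a b = 0)
    (hnc : ∀ a b a' b', a < a' → a' < b → b < b' → W a b = 0 ∨ W a' b' = 0)
    (h02 : W 0 2 = 0) (h24 : W 2 4 = 0) (h46 : W 4 6 = 0) (h06 : W 0 6 = 0) (h04 : W 0 4 = 0)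
    (F02 : ∑ a, ∑ b, W a b * cl a b 0 2 = 0) (F24 : ∑ a, ∑ b, W a b * cl a b 2 4 = 0)
    (F46 : ∑ a, ∑ b, W a b * cl a b 4 6 = 0) (F06 : ∑ a, ∑ b, W a b * cl a b 0 6 = 0)
    (F04 : ∑ a, ∑ b, W a b * cl a b 0 4 = 0) :
    ∑ a, ∑ b, W a b * cl a b 2 6 = 0 ∧ W 2 6 = 0 := by
  simp only [Fin.sum_univ_eight] at F02 F24 F46 F06 F04 ⊢
  simp [cl, hlow, h02, h24, h46, h06, h04] at F02 F24 F46 F06 F04 ⊢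
  have z03 : W 0 3 = 0 := by
    by_contra hne
    have e14 : W 1 4 = 0 := (hnc 0 3 1 4 (by decide) (by decide) (by decide)).resolve_left hne
    have e15 : W 1 5 = 0 := (hnc 0 3 1 5 (by decide) (by decide) (by decide)).resolve_left hne
    have e16 : W 1 6 = 0 := (hnc 0 3 1 6 (by decide) (by decide) (by decide)).resolve_left hne
    have e17 : W 1 7 = 0 := (hnc 0 3 1 7 (by decide) (by decide) (by decide)).resolve_left hne
    have e25 : W 2 5 = 0 := (hnc 0 3 2 5 (by decide) (by decide) (by decide)).resolve_left hne
    have e26 : W 2 6 = 0 := (hnc 0 3 2 6 (by decide) (by decide) (by decide)).resolve_left hne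
    have e27 : W 2 7 = 0 := (hnc 0 3 2 7 (by decide) (by decide) (by decide)).resolve_left hne
    exact hne (by linarith)
  have z14 : W 1 4 = 0 := by
    by_contra hne
    have e25 : W 2 5 = 0 := (hnc 1 4 2 5 (by decide) (by decide) (by decide)).resolve_left hne
    have e26 : W 2 6 = 0 := (hnc 1 4 2 6 (by decide) (by decide) (by decide)).resolve_left hne
    have e27 : W 2 7 = 0 := (hnc 1 4 2 7 (by decide) (by decide) (by decide)).resolve_left hne
    have e35 : W 3 5 = 0 := (hnc 1 4 3 5 (by decide) (by decide) (by decide)).resolve_left hne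
    have e36 : W 3 6 = 0 := (hnc 1 4 3 6 (by decide) (by decide) (by decide)).resolve_left hne
    have e37 : W 3 7 = 0 := (hnc 1 4 3 7 (by decide) (by decide) (by decide)).resolve_left hne
    exact hne (by linarith)
  have z13 : W 1 3 = 0 := by
    by_contra hne
    have e25 : W 2 5 = 0 := (hnc 1 3 2 5 (by decide) (by decide) (by decide)).resolve_left hne
    have e26 : W 2 6 = 0 := (hnc 1 3 2 6 (by decide) (by decide) (by decide)).resolve_left hne
    have e27 : W 2 7 = 0 := (hnc 1 3 2 7 (by decide) (by decide) (by decide)).resolve_left hne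
    exact hne (by linarith)
  have z05 : W 0 5 = 0 := by
    by_contra hne
    have e16 : W 1 6 = 0 := (hnc 0 5 1 6 (by decide) (by decide) (by decide)).resolve_left hne
    have e17 : W 1 7 = 0 := (hnc 0 5 1 7 (by decide) (by decide) (by decide)).resolve_left hne
    have e26 : W 2 6 = 0 := (hnc 0 5 2 6 (by decide) (by decide) (by decide)).resolve_left hne
    have e27 : W 2 7 = 0 := (hnc 0 5 2 7 (by decide) (by decide) (by decide)).resolve_left hne
    have e36 : W 3 6 = 0 := (hnc 0 5 3 6 (by decide) (by decide) (by decide)).resolve_left hne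
    have e37 : W 3 7 = 0 := (hnc 0 5 3 7 (by decide) (by decide) (by decide)).resolve_left hne
    have e47 : W 4 7 = 0 := (hnc 0 5 4 7 (by decide) (by decide) (by decide)).resolve_left hne
    exact hne (by linarith)
  have z47 : W 4 7 = 0 := by
    by_contra hne
    have e15 : W 1 5 = 0 := (hnc 1 5 4 7 (by decide) (by decide) (by decide)).resolve_right hne
    have e16 : W 1 6 = 0 := (hnc 1 6 4 7 (by decide) (by decide) (by decide)).resolve_right hne
    have e25 : W 2 5 = 0 := (hnc 2 5 4 7 (by decide) (by decide) (by decide)).resolve_right hne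
    have e26 : W 2 6 = 0 := (hnc 2 6 4 7 (by decide) (by decide) (by decide)).resolve_right hne
    have e35 : W 3 5 = 0 := (hnc 3 5 4 7 (by decide) (by decide) (by decide)).resolve_right hne
    have e36 : W 3 6 = 0 := (hnc 3 6 4 7 (by decide) (by decide) (by decide)).resolve_right hne
    exact hne (by linarith)
  have z57 : W 5 7 = 0 := by
    by_contra hne
    have e16 : W 1 6 = 0 := (hnc 1 6 5 7 (by decide) (by decide) (by decide)).resolve_right hne
    have e26 : W 2 6 = 0 := (hnc 2 6 5 7 (by decide) (by decide) (by decide)).resolve_right hne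
    have e36 : W 3 6 = 0 := (hnc 3 6 5 7 (by decide) (by decide) (by decide)).resolve_right hne
    exact hne (by linarith)
  have z15 : W 1 5 = 0 := by
    by_contra hne
    have e26 : W 2 6 = 0 := (hnc 1 5 2 6 (by decide) (by decide) (by decide)).resolve_left hne
    have e27 : W 2 7 = 0 := (hnc 1 5 2 7 (by decide) (by decide) (by decide)).resolve_left hne
    have e36 : W 3 6 = 0 := (hnc 1 5 3 6 (by decide) (by decide) (by decide)).resolve_left hne
    have e37 : W 3 7 = 0 := (hnc 1 5 3 7 (by decide) (by decide) (by decide)).resolve_left hne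
    exact hne (by linarith)
  have z37 : W 3 7 = 0 := by
    by_contra hne
    have e15 : W 1 5 = 0 := (hnc 1 5 3 7 (by decide) (by decide) (by decide)).resolve_right hne
    have e16 : W 1 6 = 0 := (hnc 1 6 3 7 (by decide) (by decide) (by decide)).resolve_right hne
    have e25 : W 2 5 = 0 := (hnc 2 5 3 7 (by decide) (by decide) (by decide)).resolve_right hne
    have e26 : W 2 6 = 0 := (hnc 2 6 3 7 (by decide) (by decide) (by decide)).resolve_right hne
    exact hne (by linarith)
  have z16 : W 1 6 = 0 := by
    by_contra hne
    have e27 : W 2 7 = 0 := (hnc 1 6 2 7 (by decide) (by decide) (by decide)).resolve_left hne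
    exact hne (by linarith)
  have z36 : W 3 6 = 0 := by
    by_contra hne
    have e25 : W 2 5 = 0 := (hnc 2 5 3 6 (by decide) (by decide) (by decide)).resolve_right hne
    exact hne (by linarith)
  constructor <;> linarith

/-- residue of `v` relative to the base point `p` -/
def nrm (M p v : ℤ) : ℤ := (v - p) % (2 * M)

theorem nrm_nonneg {M : ℤ} (hM : 0 < M) (p v : ℤ) : 0 ≤ nrm M p v :=
  Int.emod_nonneg _ (by omega)

theorem nrm_lt {M : ℤ} (hM : 0 < M) (p v : ℤ) : nrm M p v < 2 * M :=
  Int.emod_lt_of_pos _ (by omega)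

theorem nrm_spec (M p v : ℤ) : ∃ k : ℤ, v = p + nrm M p v + k * (2 * M) := by
  refine ⟨(v - p) / (2 * M), ?_⟩
  have := Int.emod_add_mul_ediv (v - p) (2 * M)
  unfold nrm
  linarith

theorem nrm_uniq {M p v t k : ℤ} (h0 : 0 ≤ t) (h1 : t < 2 * M)
    (h : v = p + t + k * (2 * M)) : nrm M p v = t := by
  unfold nrm
  rw [show v - p = t + k * (2 * M) by linarith, Int.add_mul_emod_self_right]
  exact Int.emod_eq_of_lt h0 h1

theorem nrm_rebase {M : ℤ} (hM : 0 < M) {p x : ℤ} (v : ℤ) (h1 : p ≤ x) (h2 : x < p + 2 * M) :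
    (x - p ≤ nrm M p v ∧ nrm M x v = nrm M p v - (x - p)) ∨
    (nrm M p v < x - p ∧ nrm M x v = nrm M p v - (x - p) + 2 * M) := by
  have a1 := nrm_nonneg hM p v
  have a2 := nrm_lt hM p v
  obtain ⟨k, hk⟩ := nrm_spec M p v
  rcases le_or_gt (x - p) (nrm M p v) with h | h
  · left
    refine ⟨h, nrm_uniq (k := k) (by omega) (by omega) (by linarith)⟩
  · right
    refine ⟨h, nrm_uniq (k := k - 1) (by omega) (by omega) (by linarith)⟩

theorem nrm_addM {M : ℤ} (hM : 0 < M) (p v : ℤ) :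
    (nrm M p v < M ∧ nrm M p (v + M) = nrm M p v + M) ∨
    (M ≤ nrm M p v ∧ nrm M p (v + M) = nrm M p v - M) := by
  have a1 := nrm_nonneg hM p v
  have a2 := nrm_lt hM p v
  obtain ⟨k, hk⟩ := nrm_spec M p v
  rcases lt_or_ge (nrm M p v) M with h | h
  · left
    refine ⟨h, nrm_uniq (k := k) (by omega) (by omega) (by linarith)⟩
  · right
    refine ⟨h, nrm_uniq (k := k + 1) (by omega) (by omega) (by linarith)⟩

theorem nrm_period (M p v k : ℤ) : nrm M p (v + k * (2 * M)) = nrm M p v := by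
  unfold nrm
  rw [show v + k * (2 * M) - p = (v - p) + k * (2 * M) by ring, Int.add_mul_emod_self_right]

/-- crossing number of the chords `c d` and `x y` of the `2M`-gon -/
def cnum (M c d x y : ℤ) : ℤ := cl (nrm M x c) (nrm M x d) 0 (y - x)

/-- crossing number of the symmetric pair of chords `c d` with `x y` -/
def Enum (M : ℤ) (γ : ℤ × ℤ) (x y : ℤ) : ℤ :=
  cnum M γ.1 γ.2 x y + cnum M (γ.1 + M) (γ.2 + M) x y

theorem cnum_base {M : ℤ} (hM : 0 < M) {p x y : ℤ} (c d : ℤ) (h1 : p ≤ x) (h2 : x < y)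
    (h3 : y < p + 2 * M) :
    cnum M c d x y = cl (nrm M p c) (nrm M p d) (x - p) (y - p) := by
  have a1 := nrm_nonneg hM p c
  have a2 := nrm_lt hM p c
  have b1 := nrm_nonneg hM p d
  have b2 := nrm_lt hM p d
  have e1 := nrm_rebase hM c h1 (by linarith)
  have e2 := nrm_rebase hM d h1 (by linarith)
  unfold cnum cl
  generalize nrm M p c = c0 at *
  generalize nrm M p d = d0 at *
  generalize nrm M x c = c1 at *
  generalize nrm M x d = d1 at *
  split_ifs <;> omega

theorem cnum_swap {M : ℤ} (hM : 0 < M) {x y : ℤ} (c d : ℤ) (h2 : x < y)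
    (h3 : y < x + 2 * M) :
    cnum M c d y (x + 2 * M) = cnum M c d x y := by
  have a1 := nrm_nonneg hM x c
  have a2 := nrm_lt hM x c
  have b1 := nrm_nonneg hM x d
  have b2 := nrm_lt hM x d
  have e1 := nrm_rebase hM c h2.le (by linarith)
  have e2 := nrm_rebase hM d h2.le (by linarith)
  unfold cnum cl
  generalize nrm M x c = c0 at *
  generalize nrm M x d = d0 at *
  generalize nrm M y c = c1 at *
  generalize nrm M y d = d1 at *
  split_ifs <;> omega

theorem cnum_add (M c d x y t : ℤ) : cnum M (c + t) (d + t) (x + t) (y + t) = cnum M c d x y := by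
  unfold cnum nrm
  rw [add_sub_add_right_eq_sub, add_sub_add_right_eq_sub, add_sub_add_right_eq_sub]

theorem cnum_period (M c d x y k : ℤ) :
    cnum M (c + k * (2 * M)) (d + k * (2 * M)) x y = cnum M c d x y := by
  unfold cnum
  rw [nrm_period, nrm_period]

theorem Enum_shift_one (M : ℤ) (γ : ℤ × ℤ) (x y : ℤ) :
    Enum M γ (x + M) (y + M) = Enum M γ x y := by
  unfold Enum
  rw [cnum_add]
  have h := cnum_add M (γ.1 + M) (γ.2 + M) x y M
  have h' := cnum_period M γ.1 γ.2 (x + M) (y + M) 1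
  rw [show γ.1 + M + M = γ.1 + 1 * (2 * M) by ring,
    show γ.2 + M + M = γ.2 + 1 * (2 * M) by ring] at h
  rw [h'] at h
  rw [h]; ring

theorem Enum_shift (M : ℤ) (γ : ℤ × ℤ) (x y k : ℤ) :
    Enum M γ (x + k * M) (y + k * M) = Enum M γ x y := by
  induction k using Int.induction_on with
  | zero => simp
  | succ i ih =>
    rw [← ih, ← Enum_shift_one M γ (x + i * M)]
    congr 1 <;> ring
  | pred i ih =>
    rw [← ih, ← Enum_shift_one]
    congr 1 <;> ring

theorem Enum_swap {M : ℤ} (hM : 0 < M) (γ : ℤ × ℤ) {x y : ℤ} (h2 : x < y)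
    (h3 : y < x + 2 * M) :
    Enum M γ y (x + 2 * M) = Enum M γ x y := by
  unfold Enum
  rw [cnum_swap hM _ _ h2 h3, cnum_swap hM _ _ h2 h3]

theorem Enum_orb {M : ℤ} (hM : 0 < M) (γ t : ℤ × ℤ) {x y : ℤ} (h2 : t.1 < t.2)
    (h3 : t.2 < t.1 + 2 * M) (h : Orb M t x y) :
    Enum M γ x y = Enum M γ t.1 t.2 := by
  obtain ⟨k, ⟨e1, e2⟩ | ⟨e1, e2⟩⟩ := h
  · rw [e1, e2, Enum_shift]
  · rw [e1, e2, Enum_shift, Enum_swap hM _ h2 h3]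

theorem orb_nrm {M : ℤ} (hM : 0 < M) (p : ℤ) {c d : ℤ} (h1 : c < d) (h2 : d < c + 2 * M) :
    Orb M (c, d) (p + min (nrm M p c) (nrm M p d)) (p + max (nrm M p c) (nrm M p d)) ∧
    nrm M p c ≠ nrm M p d := by
  have a1 := nrm_nonneg hM p c
  have a2 := nrm_lt hM p c
  have b1 := nrm_nonneg hM p d
  have b2 := nrm_lt hM p d
  obtain ⟨k, hk⟩ := nrm_spec M p c
  obtain ⟨l, hl⟩ := nrm_spec M p d
  generalize nrm M p c = c0 at *
  generalize nrm M p d = d0 at *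
  have e1 : -1 < l - k := by nlinarith
  have e2 : l - k < 2 := by nlinarith
  have e3 : l = k ∨ l = k + 1 := by omega
  rcases e3 with rfl | rfl
  · have : c0 < d0 := by linarith
    refine ⟨⟨-2 * l, Or.inl ?_⟩, by omega⟩
    rw [min_eq_left this.le, max_eq_right this.le]
    constructor <;> simp only <;> linarith
  · have : d0 < c0 := by linarith
    refine ⟨⟨-2 * k - 2, Or.inr ?_⟩, by omega⟩
    rw [min_eq_right this.le, max_eq_left this.le]
    constructor <;> simp only <;> linarith

theorem orb_nrm_conv {M p x y c d : ℤ} (h : Orb M (c, d) x y) (h1 : p ≤ x)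
    (h2 : x < y) (h3 : y < p + 2 * M) :
    (min (nrm M p c) (nrm M p d) = x - p ∧ max (nrm M p c) (nrm M p d) = y - p) ∨
    (min (nrm M p (c + M)) (nrm M p (d + M)) = x - p ∧
      max (nrm M p (c + M)) (nrm M p (d + M)) = y - p) := by
  obtain ⟨k, ⟨e1, e2⟩ | ⟨e1, e2⟩⟩ := h <;> simp only at e1 e2
  · obtain ⟨j, hj | hj⟩ := Int.even_or_odd' k
    · subst hj
      left
      rw [nrm_uniq (t := x - p) (k := -j) (by omega) (by omega) (by linarith),
        nrm_uniq (t := y - p) (k := -j) (by omega) (by omega) (by linarith)]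
      omega
    · subst hj
      right
      rw [nrm_uniq (t := x - p) (k := -j) (by omega) (by omega) (by linarith),
        nrm_uniq (t := y - p) (k := -j) (by omega) (by omega) (by linarith)]
      omega
  · obtain ⟨j, hj | hj⟩ := Int.even_or_odd' k
    · subst hj
      left
      rw [nrm_uniq (v := d) (t := x - p) (k := -j) (by omega) (by omega) (by linarith),
        nrm_uniq (v := c) (t := y - p) (k := -j - 1) (by omega) (by omega) (by linarith)]
      omega
    · subst hj
      right
      rw [nrm_uniq (v := d + M) (t := x - p) (k := -j) (by omega) (by omega) (by linarith),
        nrm_uniq (v := c + M) (t := y - p) (k := -j - 1) (by omega) (by omega) (by linarith)]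
      omega

theorem cl_minmax {α : Type} [LinearOrder α] (c d x y : α) :
    cl (min c d) (max c d) x y = cl c d x y := by
  rcases le_total c d with h | h
  · rw [min_eq_left h, max_eq_right h]
  · rw [min_eq_right h, max_eq_left h, cl_symm]

theorem cnum_nc {n : ℕ} {M : ℤ} (hM : 0 < M) {T : Fin n → ℤ × ℤ} (hT : Tri M T) {l : Fin n}
    {c d x y : ℤ} (hl : Orb M (T l) c d) (hx : InT M T x y) (h1 : x < y) (h2 : y < x + 2 * M) :
    (cnum M c d x y = -1 ∧ Orb M (T l) x y) ∨ (cnum M c d x y = 0 ∧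
      ¬ (min (nrm M x c) (nrm M x d) = 0 ∧ max (nrm M x c) (nrm M x d) = y - x)) := by
  have hlt := hT.orb_lt hl
  obtain ⟨ho, hne⟩ := orb_nrm hM x (c := c) (d := d) (by linarith) (by linarith)
  have ho := orb_trans hl ho
  have a1 := nrm_nonneg hM x c
  have a2 := nrm_lt hM x c
  have b1 := nrm_nonneg hM x d
  have b2 := nrm_lt hM x d
  have k1 := hT.nc _ _ _ _ hx (Or.inr (Or.inr ⟨l, ho⟩))
  unfold cnum
  rw [← cl_minmax]
  have hm : 0 ≤ min (nrm M x c) (nrm M x d) := by omega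
  have hM' : max (nrm M x c) (nrm M x d) < 2 * M := by omega
  have hmM : min (nrm M x c) (nrm M x d) < max (nrm M x c) (nrm M x d) := by omega
  generalize min (nrm M x c) (nrm M x d) = c0 at *
  generalize max (nrm M x c) (nrm M x d) = d0 at *
  by_cases he : c0 = 0 ∧ d0 = y - x
  · left
    obtain ⟨rfl, rfl⟩ := he
    refine ⟨by simp [cl], ?_⟩
    convert ho using 1 <;> ring
  · right
    refine ⟨?_, he⟩
    unfold cl
    split_ifs with g1 g2
    · omega
    · exact (k1 (by omega) (by omega) (by omega) (by omega)).elim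
    · rfl

theorem orb_M (M c d : ℤ) : Orb M (c, d) (c + M) (d + M) := ⟨1, Or.inl ⟨by simp, by simp⟩⟩

theorem Enum_nc {n : ℕ} {M : ℤ} (hM : 0 < M) {T : Fin n → ℤ × ℤ} (hT : Tri M T) {l : Fin n}
    {x y : ℤ} (hx : InT M T x y) (h1 : x < y) (h2 : y < x + 2 * M) :
    (Orb M (T l) x y → Enum M (T l) x y < 0) ∧ (¬ Orb M (T l) x y → Enum M (T l) x y = 0) := by
  have c1 := cnum_nc hM hT (orb_self M (T l)) hx h1 h2
  have c2 := cnum_nc hM hT (orb_trans (orb_self M (T l)) (orb_M M _ _)) hx h1 h2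
  unfold Enum
  constructor
  · intro ho
    have := orb_nrm_conv (c := (T l).1) (d := (T l).2) ho le_rfl h1 h2
    rw [sub_self] at this
    rcases c1 with ⟨c1, _⟩ | ⟨c1, c1'⟩ <;> rcases c2 with ⟨c2, _⟩ | ⟨c2, c2'⟩ <;>
      first | tauto | (rw [c1, c2]; norm_num)
  · intro ho
    rcases c1 with ⟨c1, _⟩ | ⟨c1, c1'⟩ <;> rcases c2 with ⟨c2, _⟩ | ⟨c2, c2'⟩ <;>
      first | contradiction | (rw [c1, c2]; norm_num)

theorem Enum_boundary {n : ℕ} {M : ℤ} (hM : 1 < M) {T : Fin n → ℤ × ℤ} (hT : Tri M T) {l : Fin n}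
    {x y : ℤ} (h : y = x + 1 ∨ y = x + 2 * M - 1) : Enum M (T l) x y = 0 := by
  refine (Enum_nc (by omega) hT ?_ (by omega) (by omega)).2 fun ho => ?_
  · rcases h with h | h
    · exact Or.inl h
    · exact Or.inr (Or.inl h)
  · have := hT.orb_lt ho
    omega

/-- position of a vertex relative to the four vertices `0 < r < q < s` -/
def reg (r q s v : ℤ) : Fin 8 :=
  if v ≤ 0 then 0 else if v < r then 1 else if v = r then 2 else if v < q then 3
  else if v = q then 4 else if v < s then 5 else if v = s then 6 else 7

theorem reg_mono (r q s : ℤ) (h2 : r < q) (h3 : q < s) : Monotone (reg r q s) := by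
  intro a b hab
  unfold reg
  split_ifs <;> omega

theorem reg_cases {r q s v : ℤ} (hv : 0 ≤ v) :
    (v = 0 ∧ (reg r q s v).val = 0) ∨ (0 < v ∧ v < r ∧ (reg r q s v).val = 1) ∨ (v = r ∧ (reg r q s v).val = 2) ∨
    (r < v ∧ v < q ∧ (reg r q s v).val = 3) ∨ (v = q ∧ (reg r q s v).val = 4) ∨
    (q < v ∧ v < s ∧ (reg r q s v).val = 5) ∨ (v = s ∧ (reg r q s v).val = 6) ∨
    (s < v ∧ (reg r q s v).val = 7) := by
  unfold reg
  split_ifs <;> simp <;> omega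

/-- two elements compare in the same way -/
def SameOrd {α β : Type} [LinearOrder α] [LinearOrder β] (a b : α) (c d : β) : Prop :=
  (a < b ↔ c < d) ∧ (b < a ↔ d < c) ∧ (a = b ↔ c = d)

theorem cl_congr {α β : Type} [LinearOrder α] [LinearOrder β] {c d x y : α} {c' d' x' y' : β}
    (h1 : SameOrd c x c' x') (h2 : SameOrd c y c' y') (h3 : SameOrd d x d' x')
    (h4 : SameOrd d y d' y') : cl c d x y = cl c' d' x' y' := by
  unfold cl
  simp only [h1.2.2, h1.2.1, h1.1, h2.2.2, h2.1, h2.2.1, h3.2.2, h3.2.1, h3.1, h4.2.2, h4.1, h4.2.1]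

theorem reg_same {r q s v : ℤ} (h1 : 0 < r) (h2 : r < q) (h3 : q < s) (hv : 0 ≤ v) :
    SameOrd v 0 (reg r q s v) 0 ∧ SameOrd v r (reg r q s v) 2 ∧ SameOrd v q (reg r q s v) 4 ∧
    SameOrd v s (reg r q s v) 6 := by
  have h := reg_cases (r := r) (q := q) (s := s) hv
  simp only [SameOrd, Fin.lt_def, Fin.ext_iff, show ((0 : Fin 8) : ℕ) = 0 from rfl,
    show ((2 : Fin 8) : ℕ) = 2 from rfl, show ((4 : Fin 8) : ℕ) = 4 from rfl,
    show ((6 : Fin 8) : ℕ) = 6 from rfl]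
  generalize (reg r q s v).val = t at *
  rcases h with h | h | h | h | h | h | h | h <;>
    refine ⟨⟨?_, ?_, ?_⟩, ⟨?_, ?_, ?_⟩, ⟨?_, ?_, ?_⟩, ⟨?_, ?_, ?_⟩⟩ <;> omega

theorem cl_reg {r q s c d : ℤ} (h1 : 0 < r) (h2 : r < q) (h3 : q < s) (hc : 0 ≤ c) (hd : 0 ≤ d) :
    cl c d 0 r = cl (reg r q s c) (reg r q s d) 0 2 ∧
    cl c d r q = cl (reg r q s c) (reg r q s d) 2 4 ∧
    cl c d q s = cl (reg r q s c) (reg r q s d) 4 6 ∧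
    cl c d 0 s = cl (reg r q s c) (reg r q s d) 0 6 ∧
    cl c d 0 q = cl (reg r q s c) (reg r q s d) 0 4 ∧
    cl c d r s = cl (reg r q s c) (reg r q s d) 2 6 := by
  obtain ⟨a1, a2, a3, a4⟩ := reg_same h1 h2 h3 hc
  obtain ⟨b1, b2, b3, b4⟩ := reg_same h1 h2 h3 hd
  exact ⟨cl_congr a1 a2 b1 b2, cl_congr a2 a3 b2 b3, cl_congr a3 a4 b3 b4, cl_congr a1 a4 b1 b4,
    cl_congr a1 a3 b1 b3, cl_congr a2 a4 b2 b4⟩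

theorem cnum_reg {M : ℤ} (hM : 0 < M) {p r q s : ℤ} (c d : ℤ) (h1 : p < r) (h2 : r < q)
    (h3 : q < s) (h4 : s < p + 2 * M) {a b : Fin 8}
    (ha : a = reg (r - p) (q - p) (s - p) (nrm M p c))
    (hb : b = reg (r - p) (q - p) (s - p) (nrm M p d)) :
    cnum M c d p r = cl a b 0 2 ∧ cnum M c d r q = cl a b 2 4 ∧
    cnum M c d q s = cl a b 4 6 ∧ cnum M c d p s = cl a b 0 6 ∧
    cnum M c d p q = cl a b 0 4 ∧ cnum M c d r s = cl a b 2 6 := by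
  subst ha hb
  rw [cnum_base hM c d (le_refl p) h1 (by linarith), cnum_base hM c d h1.le h2 (by linarith),
    cnum_base hM c d (p := p) (by linarith) h3 (by linarith),
    cnum_base hM c d (le_refl p) (x := p) (y := s) (by linarith) (by linarith),
    cnum_base hM c d (le_refl p) (x := p) (y := q) (by linarith) (by linarith),
    cnum_base hM c d (p := p) (x := r) (y := s) (by linarith) (by linarith) (by linarith), sub_self]
  exact cl_reg (by linarith) (by linarith) (by linarith) (nrm_nonneg hM _ _) (nrm_nonneg hM _ _)

theorem sg8_symm (a b : Fin 8) : sg8 a b = sg8 b a := by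
  unfold sg8
  rw [cl_symm a b, cl_symm a b, cl_symm a b, cl_symm a b]

theorem reg_even {r q s v w : ℤ} (h1 : 0 < r) (h2 : r < q) (h3 : q < s) (hv : 0 ≤ v) (hw : 0 ≤ w)
    (h : reg r q s v = reg r q s w) (he : (reg r q s v).val % 2 = 0) : v = w := by
  have g := reg_cases (r := r) (q := q) (s := s) hv
  have g' := reg_cases (r := r) (q := q) (s := s) hw
  rw [Fin.ext_iff] at h
  generalize (reg r q s v).val = t at *
  generalize (reg r q s w).val = t' at *
  subst h
  rcases g with g | g | g | g | g | g | g | g <;> omega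

theorem compat_reg {M r q s c d c' d' : ℤ} (hM : 0 < M)
    (h1 : 0 < r) (h2 : r < q) (h3 : q < s) (hc : 0 ≤ c) (hd : 0 ≤ d)
    (hc2 : c < 2 * M) (hd2 : d < 2 * M) (hne : c ≠ d) (hn1 : d ≠ c + M) (hn2 : c ≠ d + M)
    (hc' : (c < M ∧ c' = c + M) ∨ (M ≤ c ∧ c' = c - M))
    (hd' : (d < M ∧ d' = d + M) ∨ (M ≤ d ∧ d' = d - M)) :
    compat8 (reg r q s c) (reg r q s d) (reg r q s c') (reg r q s d') = true := by
  have hm := reg_mono r q s h2 h3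
  unfold compat8
  rw [← hm.map_min, ← hm.map_min, ← hm.map_max, ← hm.map_max]
  simp only [Bool.and_eq_true, Bool.not_eq_true', decide_eq_false_iff_not]
  refine ⟨⟨⟨?_, ?_⟩, ?_⟩, ?_⟩
  · rintro ⟨e1, e2, e3⟩
    have e1 := hm.reflect_lt e1
    have e2 := hm.reflect_lt e2
    have e3 := hm.reflect_lt e3
    omega
  · rintro ⟨e1, e2, e3⟩
    have e1 := hm.reflect_lt e1
    have e2 := hm.reflect_lt e2
    have e3 := hm.reflect_lt e3
    omega
  · rintro ⟨e | e, e'⟩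
    · have := reg_even h1 h2 h3 hc (by omega) e e'
      omega
    · have := reg_even h1 h2 h3 hc (by omega) e e'
      omega
  · rintro ⟨e | e, e'⟩
    · have := reg_even h1 h2 h3 hd (by omega) e e'
      omega
    · have := reg_even h1 h2 h3 hd (by omega) e e'
      omega

/-- The tropical exchange relation for crossing numbers. -/
theorem Enum_tropical {M : ℤ} (hM : 0 < M) (γ : ℤ × ℤ) (g1 : γ.1 < γ.2) (g2 : γ.2 < γ.1 + 2 * M)
    {p r q s : ℤ} (h1 : p < r) (h2 : r < q) (h3 : q < s) (h4 : s < p + 2 * M) :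
    Enum M γ p q + Enum M γ r s =
      max (Enum M γ p r + Enum M γ q s) (Enum M γ r q + Enum M γ s (p + 2 * M)) := by
  rw [Enum_swap hM γ (x := p) (by linarith) h4]
  obtain ⟨-, hne⟩ := orb_nrm hM p g1 g2
  unfold Enum
  obtain ⟨a1, a2, a3, a4, a5, a6⟩ := cnum_reg hM γ.1 γ.2 h1 h2 h3 h4 rfl rfl
  obtain ⟨b1, b2, b3, b4, b5, b6⟩ := cnum_reg hM (γ.1 + M) (γ.2 + M) h1 h2 h3 h4 rfl rfl
  rw [a1, a2, a3, a4, a5, a6, b1, b2, b3, b4, b5, b6]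
  clear a1 a2 a3 a4 a5 a6 b1 b2 b3 b4 b5 b6
  have a1 := nrm_nonneg hM p γ.1
  have a2 := nrm_lt hM p γ.1
  have b1 := nrm_nonneg hM p γ.2
  have b2 := nrm_lt hM p γ.2
  have c1 := nrm_addM hM p γ.1
  have d1 := nrm_addM hM p γ.2
  generalize nrm M p γ.1 = c at *
  generalize nrm M p γ.2 = d at *
  generalize nrm M p (γ.1 + M) = c' at *
  generalize nrm M p (γ.2 + M) = d' at *
  have hs1 := oct_single (reg (r - p) (q - p) (s - p) c) (reg (r - p) (q - p) (s - p) d)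
  have hs2 := oct_single (reg (r - p) (q - p) (s - p) c') (reg (r - p) (q - p) (s - p) d')
  have key : ¬ (0 < sg8 (reg (r - p) (q - p) (s - p) c) (reg (r - p) (q - p) (s - p) d) ∧
      sg8 (reg (r - p) (q - p) (s - p) c') (reg (r - p) (q - p) (s - p) d') < 0) ∧
      ¬ (0 < sg8 (reg (r - p) (q - p) (s - p) c') (reg (r - p) (q - p) (s - p) d') ∧
      sg8 (reg (r - p) (q - p) (s - p) c) (reg (r - p) (q - p) (s - p) d) < 0) := by
    by_cases hdiam : d = c + M ∨ c = d + M
    · have e1 : c' = d := by omega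
      have e2 : d' = c := by omega
      subst e1 e2
      rw [sg8_symm]
      omega
    · constructor
      · rintro ⟨k1, k2⟩
        have := oct_coherent _ _ k1 _ _ k2
        rw [compat_reg hM (by linarith) (by linarith) (by linarith) a1 b1 a2 b2 hne (by omega)
          (by omega) c1 d1] at this
        simp at this
      · rintro ⟨k1, k2⟩
        have := oct_coherent _ _ k1 _ _ k2
        rw [compat_reg (M := M) (c := c') (d := d') (c' := c) (d' := d) hM (by linarith)
          (by linarith) (by linarith) (by omega) (by omega) (by omega) (by omega) (by omega)
          (by omega) (by omega) (by omega) (by omega)] at this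
        simp at this
  unfold sg8 at key
  omega

/-- sorted type of a chord relative to the quadrilateral `p r q s` -/
def ty (M p r q s c d : ℤ) : Fin 8 × Fin 8 :=
  (reg (r - p) (q - p) (s - p) (min (nrm M p c) (nrm M p d)),
   reg (r - p) (q - p) (s - p) (max (nrm M p c) (nrm M p d)))

/-- weighted numbers of chords of each type -/
def Wt {n : ℕ} (M p r q s : ℤ) (T : Fin n → ℤ × ℤ) (w : Fin n → ℚ) (a b : Fin 8) : ℚ :=
  ∑ l, w l * ((if ty M p r q s (T l).1 (T l).2 = (a, b) then 1 else 0) +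
    (if ty M p r q s ((T l).1 + M) ((T l).2 + M) = (a, b) then 1 else 0))

theorem sum_ind (t : Fin 8 × Fin 8) (f : Fin 8 → Fin 8 → ℚ) :
    ∑ a, ∑ b, (if t = (a, b) then (1 : ℚ) else 0) * f a b = f t.1 t.2 := by
  rw [Finset.sum_eq_single t.1, Finset.sum_eq_single t.2]
  · simp
  · intro b _ hb
    rw [if_neg, zero_mul]
    intro h; exact hb (by rw [h])
  · simp
  · intro a _ ha
    apply Finset.sum_eq_zero
    intro b _
    rw [if_neg, zero_mul]
    intro h; exact ha (by rw [h])
  · simp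

theorem Wt_sum {n : ℕ} (M p r q s : ℤ) (T : Fin n → ℤ × ℤ) (w : Fin n → ℚ)
    (f : Fin 8 → Fin 8 → ℚ) :
    ∑ a, ∑ b, Wt M p r q s T w a b * f a b =
      ∑ l, w l * (f (ty M p r q s (T l).1 (T l).2).1 (ty M p r q s (T l).1 (T l).2).2 +
        f (ty M p r q s ((T l).1 + M) ((T l).2 + M)).1
          (ty M p r q s ((T l).1 + M) ((T l).2 + M)).2) := by
  simp only [Wt, Finset.sum_mul]
  have h1 : ∀ a : Fin 8, ∑ b : Fin 8, ∑ l, w l *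
      ((if ty M p r q s (T l).1 (T l).2 = (a, b) then 1 else 0) +
      (if ty M p r q s ((T l).1 + M) ((T l).2 + M) = (a, b) then 1 else 0)) * f a b =
      ∑ l, ∑ b : Fin 8, w l *
      ((if ty M p r q s (T l).1 (T l).2 = (a, b) then 1 else 0) +
      (if ty M p r q s ((T l).1 + M) ((T l).2 + M) = (a, b) then 1 else 0)) * f a b :=
    fun a => Finset.sum_comm
  rw [Finset.sum_congr rfl fun a _ => h1 a, Finset.sum_comm]
  refine Finset.sum_congr rfl fun l _ => ?_
  rw [← sum_ind (ty M p r q s (T l).1 (T l).2) f,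
    ← sum_ind (ty M p r q s ((T l).1 + M) ((T l).2 + M)) f, ← Finset.sum_add_distrib,
    Finset.mul_sum]
  refine Finset.sum_congr rfl fun a _ => ?_
  rw [← Finset.sum_add_distrib, Finset.mul_sum]
  refine Finset.sum_congr rfl fun b _ => ?_
  ring

theorem cl_ty {M p r q s : ℤ} (h2 : r < q) (h3 : q < s) (c d : ℤ) (x y : Fin 8) :
    cl (ty M p r q s c d).1 (ty M p r q s c d).2 x y =
    cl (reg (r - p) (q - p) (s - p) (nrm M p c)) (reg (r - p) (q - p) (s - p) (nrm M p d)) x y := by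
  have hm := reg_mono (r - p) (q - p) (s - p) (by linarith) (by linarith)
  unfold ty
  simp only [hm.map_min, hm.map_max]
  exact cl_minmax _ _ _ _

theorem ty_orb {n : ℕ} {M : ℤ} (hM : 0 < M) {T : Fin n → ℤ × ℤ} (hT : Tri M T) {l : Fin n}
    {c d : ℤ} (h : Orb M (T l) c d) {p r q s : ℤ} {a b : Fin 8}
    (hty : ty M p r q s c d = (a, b)) :
    ∃ lo hi, 0 ≤ lo ∧ lo < hi ∧ hi < 2 * M ∧ Orb M (T l) (p + lo) (p + hi) ∧
      reg (r - p) (q - p) (s - p) lo = a ∧ reg (r - p) (q - p) (s - p) hi = b := by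
  have hlt := hT.orb_lt h
  obtain ⟨ho, hne⟩ := orb_nrm hM p (c := c) (d := d) (by linarith) (by linarith)
  have ho := orb_trans h ho
  have a1 := nrm_nonneg hM p c
  have a2 := nrm_lt hM p c
  have b1 := nrm_nonneg hM p d
  have b2 := nrm_lt hM p d
  unfold ty at hty
  rw [Prod.mk.injEq] at hty
  exact ⟨_, _, by omega, by omega, by omega, ho, hty.1, hty.2⟩

theorem Wt_supp {n : ℕ} {M : ℤ} (hM : 0 < M) {T : Fin n → ℤ × ℤ} (hT : Tri M T)
    {p r q s : ℤ} {w : Fin n → ℚ} {a b : Fin 8} (h : Wt M p r q s T w a b ≠ 0) :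
    ∃ l lo hi, w l ≠ 0 ∧ 0 ≤ lo ∧ lo < hi ∧ hi < 2 * M ∧ Orb M (T l) (p + lo) (p + hi) ∧
      reg (r - p) (q - p) (s - p) lo = a ∧ reg (r - p) (q - p) (s - p) hi = b := by
  obtain ⟨l, -, hl⟩ := Finset.exists_ne_zero_of_sum_ne_zero h
  have hw : w l ≠ 0 := left_ne_zero_of_mul hl
  have hl' := right_ne_zero_of_mul hl
  refine ⟨l, ?_⟩
  by_cases h1 : ty M p r q s (T l).1 (T l).2 = (a, b)
  · obtain ⟨lo, hi, h⟩ := ty_orb hM hT (orb_self M (T l)) h1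
    exact ⟨lo, hi, hw, h⟩
  · by_cases h2 : ty M p r q s ((T l).1 + M) ((T l).2 + M) = (a, b)
    · obtain ⟨lo, hi, h⟩ := ty_orb hM hT (orb_M M (T l).1 (T l).2) h2
      exact ⟨lo, hi, hw, h⟩
    · simp [h1, h2] at hl'

theorem reg_pts {r q s : ℤ} (h1 : 0 < r) (h2 : r < q) (h3 : q < s) :
    reg r q s 0 = 0 ∧ reg r q s r = 2 ∧ reg r q s q = 4 ∧ reg r q s s = 6 := by
  unfold reg
  refine ⟨by simp, ?_, ?_, ?_⟩ <;> split_ifs <;> first | rfl | omega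

theorem F_lemma {n : ℕ} {M : ℤ} (hM : 0 < M) {T : Fin n → ℤ × ℤ} (hT : Tri M T)
    {p r q s : ℤ} (h1 : p < r) (h2 : r < q) (h3 : q < s) (h4 : s < p + 2 * M)
    {w : Fin n → ℚ}
    (hE : ∀ x y, (x = p ∧ y = r) ∨ (x = r ∧ y = q) ∨ (x = q ∧ y = s) ∨ (x = p ∧ y = s) ∨
      (x = p ∧ y = q) → (∑ l, w l * (Enum M (T l) x y : ℚ) = 0) ∧
        ∀ l, Orb M (T l) x y → w l = 0) :
    ∑ l, w l * (Enum M (T l) r s : ℚ) = 0 ∧ ∀ l, Orb M (T l) r s → w l = 0 := by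
  obtain ⟨r0, r2, r4, r6⟩ := reg_pts (r := r - p) (q := q - p) (s := s - p)
    (by linarith) (by linarith) (by linarith)
  have ev : ∀ v u, 0 ≤ v → 0 ≤ u → (reg (r - p) (q - p) (s - p) v).val % 2 = 0 →
      reg (r - p) (q - p) (s - p) v = reg (r - p) (q - p) (s - p) u → v = u :=
    fun v u hv hu he e => reg_even (by linarith) (by linarith) (by linarith) hv hu e he
  have hm := reg_mono (r - p) (q - p) (s - p) (by linarith) (by linarith)
  have zero : ∀ x y, p ≤ x → x < y → y < p + 2 * M →
      (reg (r - p) (q - p) (s - p) (x - p)).val % 2 = 0 →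
      (reg (r - p) (q - p) (s - p) (y - p)).val % 2 = 0 →
      (∀ l, Orb M (T l) x y → w l = 0) →
      Wt M p r q s T w (reg (r - p) (q - p) (s - p) (x - p))
        (reg (r - p) (q - p) (s - p) (y - p)) = 0 := by
    intro x y hx hxy hy ex ey hw
    by_contra hne
    obtain ⟨l, lo, hi, g1, g2, g3, g4, g5, g6, g7⟩ := Wt_supp hM hT hne
    obtain rfl : lo = x - p := ev _ _ g2 (by linarith) (by rw [g6]; exact ex) g6
    obtain rfl : hi = y - p := ev _ _ (by linarith) (by linarith) (by rw [g7]; exact ey) g7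
    refine g1 (hw l ?_)
    convert g5 using 1 <;> ring
  have sumE : ∀ (x y : ℤ) (a b : Fin 8),
      (∀ c d, cnum M c d x y = cl (reg (r - p) (q - p) (s - p) (nrm M p c))
        (reg (r - p) (q - p) (s - p) (nrm M p d)) a b) →
      ∑ a', ∑ b', Wt M p r q s T w a' b' * (cl a' b' a b : ℚ) =
        ∑ l, w l * (Enum M (T l) x y : ℚ) := by
    intro x y a b h
    rw [Wt_sum M p r q s T w (fun a' b' => (cl a' b' a b : ℚ))]
    refine Finset.sum_congr rfl fun l _ => ?_
    rw [cl_ty h2 h3, cl_ty h2 h3, ← h, ← h]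
    unfold Enum
    push_cast
    rfl
  have C := fun c d => cnum_reg hM c d h1 h2 h3 h4 rfl rfl
  have hoct := octF (Wt M p r q s T w) ?_ ?_
    (by have := zero p r le_rfl h1 (by linarith) (by simp [r0]) (by simp [r2])
          (hE p r (by simp)).2
        rwa [sub_self, r0, r2] at this)
    (by have := zero r q h1.le h2 (by linarith) (by simp [r2]) (by simp [r4])
          (hE r q (by simp)).2
        rwa [r2, r4] at this)
    (by have := zero q s (by linarith) h3 (by linarith) (by simp [r4]) (by simp [r6])
          (hE q s (by simp)).2
        rwa [r4, r6] at this)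
    (by have := zero p s (by linarith) (by linarith) (by linarith) (by simp [r0]) (by simp [r6])
          (hE p s (by simp)).2
        rwa [sub_self, r0, r6] at this)
    (by have := zero p q (by linarith) (by linarith) (by linarith) (by simp [r0]) (by simp [r4])
          (hE p q (by simp)).2
        rwa [sub_self, r0, r4] at this)
    ((sumE p r 0 2 fun c d => (C c d).1).trans (hE p r (by simp)).1)
    ((sumE r q 2 4 fun c d => (C c d).2.1).trans (hE r q (by simp)).1)
    ((sumE q s 4 6 fun c d => (C c d).2.2.1).trans (hE q s (by simp)).1)
    ((sumE p s 0 6 fun c d => (C c d).2.2.2.1).trans (hE p s (by simp)).1)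
    ((sumE p q 0 4 fun c d => (C c d).2.2.2.2.1).trans (hE p q (by simp)).1)
  · obtain ⟨o1, o2⟩ := hoct
    refine ⟨(sumE r s 2 6 fun c d => (C c d).2.2.2.2.2).symm.trans o1, ?_⟩
    intro l hl
    unfold Wt at o2
    rw [Finset.sum_eq_single l] at o2
    · have hty : ty M p r q s (T l).1 (T l).2 = (2, 6) ∨
          ty M p r q s ((T l).1 + M) ((T l).2 + M) = (2, 6) := by
        rcases orb_nrm_conv (c := (T l).1) (d := (T l).2) hl h1.le (by linarith) h4 with
          ⟨g1, g2⟩ | ⟨g1, g2⟩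
        · left; unfold ty; rw [g1, g2, r2, r6]
        · right; unfold ty; rw [g1, g2, r2, r6]
      rcases mul_eq_zero.1 o2 with h | h
      · exact h
      · exfalso
        rcases hty with h' | h' <;> rw [if_pos h'] at h <;> split_ifs at h <;> norm_num at h
    · intro i _ hi
      have no : ∀ c d, Orb M (T i) c d → ty M p r q s c d ≠ (2, 6) := by
        intro c d ho hty
        obtain ⟨lo, hi', g2, g3, g4, g5, g6, g7⟩ := ty_orb hM hT ho hty
        obtain rfl : lo = r - p := ev _ _ g2 (by linarith) (by rw [g6]; rfl) (g6.trans r2.symm)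
        obtain rfl : hi' = s - p :=
          ev _ _ (by linarith) (by linarith) (by rw [g7]; rfl) (g7.trans r6.symm)
        refine hi (hT.inj i l r s ?_ hl)
        convert g5 using 1 <;> ring
      rw [if_neg (no _ _ (orb_self M (T i))), if_neg (no _ _ (orb_M M _ _))]
      simp
    · simp
  · intro a b hab
    by_contra hne
    obtain ⟨l, lo, hi, g1, g2, g3, g4, g5, g6, g7⟩ := Wt_supp hM hT hne
    rw [← g6, ← g7] at hab
    exact absurd (hm.reflect_lt hab) (by linarith)
  · intro a b a' b' k1 k2 k3
    by_contra! hne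
    obtain ⟨l, lo, hi, g1, g2, g3, g4, g5, g6, g7⟩ := Wt_supp hM hT hne.1
    obtain ⟨l', lo', hi', g1', g2', g3', g4', g5', g6', g7'⟩ := Wt_supp hM hT hne.2
    rw [← g6, ← g6'] at k1
    rw [← g7, ← g6'] at k2
    rw [← g7, ← g7'] at k3
    have k1 := hm.reflect_lt k1
    have k2 := hm.reflect_lt k2
    have k3 := hm.reflect_lt k3
    exact hT.nc _ _ _ _ (Or.inr (Or.inr ⟨l, g5⟩)) (Or.inr (Or.inr ⟨l', g5'⟩))
      (by linarith) (by linarith) (by linarith) (by linarith)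

/-- `a` is the exact exponent of `X i` in `f` -/
def Vl {n : ℕ} (i : Fin n) (f : MvPolynomial (Fin n) ℚ) (a : ℕ) : Prop :=
  ∃ g, f = X i ^ a * g ∧ ¬ X i ∣ g

theorem X_dvd_iff_coeff {n : ℕ} {R : Type} [CommRing R] (i : Fin n) (f : MvPolynomial (Fin n) R) :
    X i ∣ f ↔ ∀ m : Fin n →₀ ℕ, m i = 0 → coeff m f = 0 := by
  rw [X_dvd_iff_modMonomial_eq_zero]
  constructor
  · intro h m hm
    have := coeff_modMonomial_of_not_le (s' := m) f (s := Finsupp.single i 1) (by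
      intro hle
      have := hle i
      simp [hm] at this)
    rw [← this, h, coeff_zero]
  · intro h
    ext m
    rw [coeff_zero]
    by_cases hle : Finsupp.single i 1 ≤ m
    · exact coeff_modMonomial_of_le _ hle
    · rw [coeff_modMonomial_of_not_le _ hle]
      apply h
      by_contra hne
      apply hle
      rw [Finsupp.single_le_iff]
      omega

theorem Vl.mul {n : ℕ} {i : Fin n} {f f' : MvPolynomial (Fin n) ℚ} {a a' : ℕ}
    (h : Vl i f a) (h' : Vl i f' a') : Vl i (f * f') (a + a') := by
  obtain ⟨g, rfl, hg⟩ := h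
  obtain ⟨g', rfl, hg'⟩ := h'
  refine ⟨g * g', by ring, fun hd => ?_⟩
  rcases (X_prime (R := ℚ) (i := i)).dvd_or_dvd hd with h | h
  · exact hg h
  · exact hg' h

theorem Vl.uniq {n : ℕ} {i : Fin n} {f : MvPolynomial (Fin n) ℚ} {a a' : ℕ}
    (h : Vl i f a) (h' : Vl i f a') : a = a' := by
  have key : ∀ (a a' : ℕ) (g g' : MvPolynomial (Fin n) ℚ), X i ^ a * g = X i ^ a' * g' →
      ¬ X i ∣ g → ¬ a < a' := by
    intro a a' g g' he hg hlt
    obtain ⟨k, rfl⟩ := Nat.exists_eq_add_of_lt hlt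
    apply hg
    have : X i ^ a * g = X i ^ a * (X i * (X i ^ k * g')) := by rw [he]; ring
    exact ⟨_, mul_left_cancel₀ (pow_ne_zero _ (X_prime (R := ℚ) (i := i)).ne_zero) this⟩
  obtain ⟨g, rfl, hg⟩ := h
  obtain ⟨g', he, hg'⟩ := h'
  have k1 := key _ _ _ _ he hg
  have k2 := key _ _ _ _ he.symm hg'
  omega

/-- polynomials with nonnegative coefficients -/
def PosP {n : ℕ} (f : MvPolynomial (Fin n) ℚ) : Prop := f ≠ 0 ∧ ∀ m, 0 ≤ coeff m f

theorem PosP.mul {n : ℕ} {f g : MvPolynomial (Fin n) ℚ} (h : PosP f) (h' : PosP g) :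
    PosP (f * g) := by
  refine ⟨mul_ne_zero h.1 h'.1, fun m => ?_⟩
  rw [coeff_mul]
  exact Finset.sum_nonneg fun x _ => mul_nonneg (h.2 _) (h'.2 _)

theorem PosP.add {n : ℕ} {f g : MvPolynomial (Fin n) ℚ} (h : PosP f) (h' : PosP g) :
    PosP (f + g) := by
  refine ⟨fun h0 => ?_, fun m => ?_⟩
  · obtain ⟨m, hm⟩ := ne_zero_iff.1 h.1
    have h1 := h.2 m
    have h2 := h'.2 m
    have h3 : coeff m f + coeff m g = 0 := by rw [← coeff_add, h0, coeff_zero]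
    exact hm (by linarith)
  · rw [coeff_add]; exact add_nonneg (h.2 _) (h'.2 _)

theorem Vl.add_le {n : ℕ} {i : Fin n} {f f' : MvPolynomial (Fin n) ℚ} {a a' : ℕ}
    (h : Vl i f a) (h' : Vl i f' a') (hf : PosP f) (hf' : PosP f') (hle : a ≤ a') :
    Vl i (f + f') a := by
  obtain ⟨g, rfl, hg⟩ := h
  obtain ⟨g', rfl, hg'⟩ := h'
  obtain ⟨k, rfl⟩ := Nat.exists_eq_add_of_le hle
  have hp : ∀ (a : ℕ) (g : MvPolynomial (Fin n) ℚ), PosP (X i ^ a * g) → ∀ m, 0 ≤ coeff m g := by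
    intro a g hg m
    have := hg.2 (Finsupp.single i a + m)
    rw [X_pow_eq_monomial, coeff_monomial_mul, one_mul] at this
    exact this
  refine ⟨g + X i ^ k * g', by ring, fun hd => hg ?_⟩
  rw [X_dvd_iff_coeff] at hd ⊢
  intro m hm
  have h1 := hd m hm
  rw [coeff_add] at h1
  have h2 := hp _ _ hf m
  have h3 := hp a (X i ^ k * g') (by convert hf' using 1; ring) m
  linarith

theorem Vl.add {n : ℕ} {i : Fin n} {f f' : MvPolynomial (Fin n) ℚ} {a a' : ℕ}
    (h : Vl i f a) (h' : Vl i f' a') (hf : PosP f) (hf' : PosP f') :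
    Vl i (f + f') (min a a') := by
  rcases le_total a a' with hle | hle
  · rw [min_eq_left hle]; exact h.add_le h' hf hf' hle
  · rw [min_eq_right hle, add_comm]; exact h'.add_le h hf' hf hle

/-- `y` is a subtraction free expression with tropical denominator vector `t` -/
def Trop {n : ℕ} (y : CAField n) (t : Fin n → ℤ) : Prop :=
  ∃ f g : MvPolynomial (Fin n) ℚ, PosP f ∧ PosP g ∧
    y * algebraMap _ (CAField n) g = algebraMap _ (CAField n) f ∧
    ∀ i, ∃ a b : ℕ, Vl i f a ∧ Vl i g b ∧ t i = (b : ℤ) - a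

theorem Vl_prod {n : ℕ} (i : Fin n) (k : Fin n → ℕ) : Vl i (∏ j, X j ^ k j) (k i) := by
  refine ⟨∏ j ∈ Finset.univ.erase i, X j ^ k j, ?_, fun hd => ?_⟩
  · rw [Finset.mul_prod_erase Finset.univ (fun j => (X j : MvPolynomial (Fin n) ℚ) ^ k j)
      (Finset.mem_univ i)]
  · obtain ⟨j, hj, hd⟩ := (X_prime (R := ℚ) (i := i)).exists_mem_finset_dvd hd
    have hd := (X_prime (R := ℚ) (i := i)).dvd_of_dvd_pow hd
    rw [X_dvd_X] at hd
    exact (Finset.mem_erase.1 hj).1 hd.symm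

theorem Vl_one {n : ℕ} (i : Fin n) : Vl i (1 : MvPolynomial (Fin n) ℚ) 0 :=
  ⟨1, by simp, (X_prime (R := ℚ) (i := i)).not_dvd_one⟩

theorem PosP_one {n : ℕ} : PosP (1 : MvPolynomial (Fin n) ℚ) := by
  refine ⟨one_ne_zero, fun m => ?_⟩
  rw [coeff_one]; split_ifs <;> norm_num

theorem PosP_X {n : ℕ} (j : Fin n) : PosP (X j : MvPolynomial (Fin n) ℚ) := by
  refine ⟨(X_prime (R := ℚ) (i := j)).ne_zero, fun m => ?_⟩
  rw [coeff_X]; split_ifs <;> norm_num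

theorem Trop_one {n : ℕ} : Trop (1 : CAField n) 0 :=
  ⟨1, 1, PosP_one, PosP_one, by simp, fun i => ⟨0, 0, Vl_one i, Vl_one i, by simp⟩⟩

theorem Trop_uVar {n : ℕ} (j : Fin n) : Trop (uVar n j) (fun i => if i = j then -1 else 0) := by
  refine ⟨X j, 1, PosP_X j, PosP_one, by simp [uVar], fun i => ?_⟩
  by_cases h : i = j
  · subst h
    exact ⟨1, 0, ⟨1, by simp, (X_prime (R := ℚ) (i := i)).not_dvd_one⟩, Vl_one i, by simp⟩
  · refine ⟨0, 0, ⟨X j, by simp, fun hd => ?_⟩, Vl_one i, by simp [h]⟩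
    rw [X_dvd_X] at hd
    exact h hd

theorem Trop.mul {n : ℕ} {y y' : CAField n} {t t' : Fin n → ℤ} (h : Trop y t) (h' : Trop y' t') :
    Trop (y * y') (t + t') := by
  obtain ⟨f, g, hf, hg, he, hv⟩ := h
  obtain ⟨f', g', hf', hg', he', hv'⟩ := h'
  refine ⟨f * f', g * g', hf.mul hf', hg.mul hg', ?_, fun i => ?_⟩
  · rw [map_mul, map_mul, ← he, ← he']; ring
  · obtain ⟨a, b, h1, h2, h3⟩ := hv i
    obtain ⟨a', b', h1', h2', h3'⟩ := hv' i
    refine ⟨_, _, h1.mul h1', h2.mul h2', ?_⟩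
    rw [Pi.add_apply, h3, h3']; push_cast; ring

theorem alg_ne {n : ℕ} {f : MvPolynomial (Fin n) ℚ} (h : f ≠ 0) :
    algebraMap (MvPolynomial (Fin n) ℚ) (CAField n) f ≠ 0 := by
  rwa [Ne, FaithfulSMul.algebraMap_eq_zero_iff]

theorem Trop.ne_zero {n : ℕ} {y : CAField n} {t : Fin n → ℤ} (h : Trop y t) : y ≠ 0 := by
  obtain ⟨f, g, hf, hg, he, hv⟩ := h
  rintro rfl
  rw [zero_mul] at he
  exact alg_ne hf.1 he.symm

theorem Trop.div {n : ℕ} {y y' : CAField n} {t t' : Fin n → ℤ} (h : Trop y t) (h' : Trop y' t') :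
    Trop (y / y') (t - t') := by
  have hy' := h'.ne_zero
  obtain ⟨f, g, hf, hg, he, hv⟩ := h
  obtain ⟨f', g', hf', hg', he', hv'⟩ := h'
  refine ⟨f * g', g * f', hf.mul hg', hg.mul hf', ?_, fun i => ?_⟩
  · rw [map_mul, map_mul, ← he, ← he']; field_simp
  · obtain ⟨a, b, h1, h2, h3⟩ := hv i
    obtain ⟨a', b', h1', h2', h3'⟩ := hv' i
    refine ⟨_, _, h1.mul h2', h2.mul h1', ?_⟩
    rw [Pi.sub_apply, h3, h3']; push_cast; ring

theorem Trop.add {n : ℕ} {y y' : CAField n} {t t' : Fin n → ℤ} (h : Trop y t) (h' : Trop y' t') :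
    Trop (y + y') (fun i => max (t i) (t' i)) := by
  obtain ⟨f, g, hf, hg, he, hv⟩ := h
  obtain ⟨f', g', hf', hg', he', hv'⟩ := h'
  refine ⟨f * g' + f' * g, g * g', (hf.mul hg').add (hf'.mul hg), hg.mul hg', ?_, fun i => ?_⟩
  · rw [map_add, map_mul, map_mul, map_mul, ← he, ← he']; ring
  · obtain ⟨a, b, h1, h2, h3⟩ := hv i
    obtain ⟨a', b', h1', h2', h3'⟩ := hv' i
    refine ⟨_, _, (h1.mul h2').add (h1'.mul h2) (hf.mul hg') (hf'.mul hg), h2.mul h2', ?_⟩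
    simp only [h3, h3']; push_cast; omega

theorem Trop.pow {n : ℕ} {y : CAField n} {t : Fin n → ℤ} (h : Trop y t) (k : ℕ) :
    Trop (y ^ k) (fun i => k * t i) := by
  induction k with
  | zero => convert (Trop_one : Trop (1 : CAField n) 0) using 1 <;> (try ext) <;> simp
  | succ k ih =>
    rw [pow_succ]
    convert ih.mul h using 1
    ext i
    simp only [Pi.add_apply]; push_cast; ring

theorem Trop_prod {n : ℕ} {y : Fin n → CAField n} {t : Fin n → Fin n → ℤ}
    (h : ∀ j, Trop (y j) (t j)) (k : Fin n → ℕ) (S : Finset (Fin n)) :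
    Trop (∏ j ∈ S, y j ^ k j) (fun i => ∑ j ∈ S, k j * t j i) := by
  induction S using Finset.induction_on with
  | empty => convert (Trop_one : Trop (1 : CAField n) 0) using 1 <;> (try ext) <;> simp
  | insert a S ha ih =>
    rw [Finset.prod_insert ha]
    convert ((h a).pow (k a)).mul ih using 1
    ext i
    rw [Finset.sum_insert ha]; rfl

theorem Trop.denom {n : ℕ} {y : CAField n} {t d : Fin n → ℤ} (h : Trop y t)
    (hd : IsDenomVec (uVar n) y d) : d = t := by
  obtain ⟨f, g, hf, hg, he, hv⟩ := h
  obtain ⟨F, hF, hy⟩ := hd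
  have hne : ∀ i, uVar n i ≠ 0 := fun i => (Trop_uVar i).ne_zero
  have hpow : ∀ i, uVar n i ^ d i = uVar n i ^ (d i).toNat / uVar n i ^ (-d i).toNat := by
    intro i
    rw [← zpow_natCast, ← zpow_natCast, ← zpow_sub₀ (hne i)]
    congr 1
    omega
  have hprod : ∀ k : Fin n → ℕ, ∏ i, uVar n i ^ k i =
      algebraMap (MvPolynomial (Fin n) ℚ) (CAField n) (∏ i, X i ^ k i) := by
    intro k
    rw [map_prod]
    simp [uVar]
  have hF' : MvPolynomial.aeval (uVar n) F =
      algebraMap (MvPolynomial (Fin n) ℚ) (CAField n) (MvPolynomial.map (Int.castRingHom ℚ) F) := by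
    clear hy hF
    induction F using MvPolynomial.induction_on with
    | C a => simp
    | add p q hp hq => rw [map_add, map_add, map_add, hp, hq]
    | mul_X p i hp =>
      rw [map_mul, map_mul, map_mul, hp, aeval_X, map_X]
      rfl
  rw [Finset.prod_congr rfl fun i _ => hpow i, Finset.prod_div_distrib, hprod, hprod, hF'] at hy
  have hp1 := alg_ne (n := n) (f := ∏ i, X i ^ (d i).toNat)
    (Finset.prod_ne_zero_iff.2 fun i _ => pow_ne_zero _ (PosP_X i).1)
  have hp2 := alg_ne (n := n) (f := ∏ i, X i ^ (-d i).toNat)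
    (Finset.prod_ne_zero_iff.2 fun i _ => pow_ne_zero _ (PosP_X i).1)
  have e : f * ∏ i, X i ^ (d i).toNat =
      MvPolynomial.map (Int.castRingHom ℚ) F * (∏ i, X i ^ (-d i).toNat) * g := by
    apply IsFractionRing.injective (MvPolynomial (Fin n) ℚ) (CAField n)
    rw [map_mul, map_mul, map_mul, ← he, hy]
    field_simp
  ext i
  obtain ⟨a, b, h1, h2, h3⟩ := hv i
  have hFv : Vl i (MvPolynomial.map (Int.castRingHom ℚ) F) 0 := by
    refine ⟨_, by rw [pow_zero, one_mul], fun hx => hF i ?_⟩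
    rw [X_dvd_iff_coeff] at hx ⊢
    intro m hm
    have := hx m hm
    rw [coeff_map] at this
    rw [eq_intCast] at this
    exact_mod_cast this
  have v1 := h1.mul (Vl_prod i fun i => (d i).toNat)
  have v2 := (hFv.mul (Vl_prod i fun i => (-d i).toNat)).mul h2
  rw [← e] at v2
  have := v1.uniq v2
  omega

section initial

variable {n : ℕ} {A : ℕ → ℤ}

/-- The nested arcs. -/
def TA (n : ℕ) (A : ℕ → ℤ) : Fin n → ℤ × ℤ := fun i => (A i, A i + i + 2)

/-- Admissible left endpoints. -/
structure Adm (n : ℕ) (A : ℕ → ℤ) : Prop where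
  two : 2 ≤ n
  step : ∀ i, i + 1 < n → A i = A (i + 1) ∨ A i = A (i + 1) + 1
  last : ∀ i, i + 1 = n → A i = 0

theorem Adm.nested (h : Adm n A) {i j : ℕ} (hij : i ≤ j) (hj : j < n) :
    A j ≤ A i ∧ A i + i ≤ A j + j := by
  induction j, hij using Nat.le_induction with
  | base => simp
  | succ m hm ih =>
    have h1 := ih (by omega)
    have h2 := h.step m hj
    push_cast
    omega

theorem Adm.bounds (h : Adm n A) {i : ℕ} (hi : i < n) :
    0 ≤ A i ∧ A i + i + 2 ≤ n + 1 := by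
  have h0 := h.two
  have h1 := h.nested (i := i) (j := n - 1) (by omega) (by omega)
  have h2 := h.last (n - 1) (by omega)
  rw [h2] at h1
  omega

theorem TA_orb {i : Fin n} {x y : ℤ} (h : Orb (n + 1 : ℤ) (TA n A i) x y) :
    ∃ k : ℤ, (x = A i + k * (n + 1) ∧ y = A i + i + 2 + k * (n + 1)) ∨
      (x = A i + i + 2 + k * (n + 1) ∧ y = A i + (k + 2) * (n + 1)) := by
  obtain ⟨k, h⟩ := h
  refine ⟨k, ?_⟩
  rcases h with ⟨h1, h2⟩ | ⟨h1, h2⟩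
  · left; exact ⟨h1, h2⟩
  · right; refine ⟨h1, ?_⟩
    rw [h2]; simp only [TA]; ring

theorem TA_inj {i j : Fin n} {x y : ℤ} (h : Orb (n + 1 : ℤ) (TA n A i) x y)
    (h' : Orb (n + 1 : ℤ) (TA n A j) x y) : i = j := by
  have e1 : y - x = i + 2 ∨ y - x = 2 * n - i := by
    obtain ⟨k, ⟨h1, h2⟩ | ⟨h1, h2⟩⟩ := TA_orb h <;> rw [h1, h2]
    · left; ring
    · right; ring
  have e2 : y - x = j + 2 ∨ y - x = 2 * n - j := by
    obtain ⟨k, ⟨h1, h2⟩ | ⟨h1, h2⟩⟩ := TA_orb h' <;> rw [h1, h2]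
    · left; ring
    · right; ring
  have := i.2
  have := j.2
  ext
  omega

theorem TA_ss (hA : Adm n A) {i j : ℕ} (hi : i < n) (hj : j < n) {k l : ℤ}
    (h1 : A i + k * (n + 1) < A j + l * (n + 1))
    (h2 : A j + l * (n + 1) < A i + i + 2 + k * (n + 1))
    (h3 : A i + i + 2 + k * (n + 1) < A j + j + 2 + l * (n + 1)) : False := by
  have b1 := hA.bounds hi
  have b2 := hA.bounds hj
  have k1 : l < k + 1 := by
    by_contra hc
    push Not at hc
    have : (k + 1) * ((n : ℤ) + 1) ≤ l * (n + 1) := mul_le_mul_of_nonneg_right hc (by omega)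
    linarith
  have k2 : k < l + 1 := by
    by_contra hc
    push Not at hc
    have : (l + 1) * ((n : ℤ) + 1) ≤ k * (n + 1) := mul_le_mul_of_nonneg_right hc (by omega)
    linarith
  obtain rfl : k = l := by omega
  rcases le_total i j with hij | hij
  · have := hA.nested hij hj
    omega
  · have := hA.nested hij hi
    omega

theorem TA_nc (hA : Adm n A) (a b c d : ℤ) (h1 : InT (n + 1 : ℤ) (TA n A) a b)
    (h2 : InT (n + 1 : ℤ) (TA n A) c d) (e1 : a < c) (e2 : c < b) (e3 : b < d)
    (e4 : d < a + 2 * (n + 1)) : False := by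
  rcases h1 with h1 | h1 | ⟨i, h1⟩
  · omega
  · omega
  rcases h2 with h2 | h2 | ⟨j, h2⟩
  · omega
  · omega
  obtain ⟨k, ⟨f1, f2⟩ | ⟨f1, f2⟩⟩ := TA_orb h1 <;> obtain ⟨l, ⟨g1, g2⟩ | ⟨g1, g2⟩⟩ := TA_orb h2
  · exact TA_ss hA i.2 j.2 (k := k) (l := l) (by linarith) (by linarith) (by linarith)
  · exact TA_ss hA j.2 i.2 (k := l) (l := k) (by linarith) (by linarith) (by linarith)
  · exact TA_ss hA j.2 i.2 (k := l) (l := k + 2) (by linarith) (by linarith) (by linarith)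
  · exact TA_ss hA i.2 j.2 (k := k) (l := l) (by linarith) (by linarith) (by linarith)

theorem TA_len (i : Fin n) : (TA n A i).1 + 1 < (TA n A i).2 ∧
    (TA n A i).2 < (TA n A i).1 + 2 * (n + 1) - 1 := by
  have := i.2
  simp only [TA]
  constructor <;> omega

theorem eTA_orb {i m : Fin n} {x y : ℤ} (h : Orb (n + 1 : ℤ) (TA n A m) x y) :
    eT (n + 1 : ℤ) (TA n A) i x y = if i = m then 1 else 0 := by
  split_ifs with him
  · subst him; exact eT_pos h
  · exact eT_neg fun h' => him (TA_inj h' h)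

theorem eTA_bd {i : Fin n} {x y : ℤ} (h : y = x + 1) :
    eT (n + 1 : ℤ) (TA n A) i x y = 0 := by
  refine eT_neg fun h' => ?_
  have := orb_len h' (TA_len i).1 (TA_len i).2
  omega

/-- value of the inner contribution -/
def inn (A : ℕ → ℤ) (i j : ℕ) : ℤ :=
  if i + 1 = j then (if A i = A j then 1 else -1) else 0

/-- value of the outer contribution -/
def out (n : ℕ) (A : ℕ → ℤ) (i j : ℕ) : ℤ :=
  if j + 1 = n then inn A i j else if i = j + 1 then (if A j = A i then -1 else 1) else 0

theorem TA_inner (hA : Adm n A) (j : Fin n) : ∃ c, A j < c ∧ c < A j + j + 2 ∧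
    InT (n + 1 : ℤ) (TA n A) (A j) c ∧ InT (n + 1 : ℤ) (TA n A) c (A j + j + 2) ∧
    ∀ i : Fin n, eT (n + 1 : ℤ) (TA n A) i (A j) c -
      eT (n + 1 : ℤ) (TA n A) i c (A j + j + 2) = inn A i j := by
  rcases Nat.eq_zero_or_pos (j : ℕ) with h0 | h0
  · refine ⟨A j + 1, by omega, by omega, Or.inl rfl, Or.inl (by omega), fun i => ?_⟩
    rw [eTA_bd rfl, eTA_bd (by omega), inn, if_neg (by omega)]; rfl
  · obtain ⟨m, hm⟩ : ∃ m : ℕ, (j : ℕ) = m + 1 := ⟨j - 1, by omega⟩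
    have hmn : m < n := by have := j.2; omega
    have hmi : ∀ i : Fin n, i = (⟨m, hmn⟩ : Fin n) ↔ (i : ℕ) + 1 = j := by
      intro i; rw [Fin.ext_iff]; simp only; omega
    have ho := orb_self (n + 1 : ℤ) (TA n A ⟨m, hmn⟩)
    simp only [TA] at ho
    have ho' : Orb (n + 1 : ℤ) (TA n A ⟨m, hmn⟩) (A m) (A m + m + 2) := ho
    have hs := hA.step m (by have := j.2; omega)
    rw [← hm] at hs
    rcases hs with hs | hs
    · have ho2 : Orb (n + 1 : ℤ) (TA n A ⟨m, hmn⟩) (A j) (A j + j + 1) := by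
        convert ho' using 1 <;> omega
      refine ⟨A j + j + 1, by omega, by omega, Or.inr (Or.inr ⟨_, ho2⟩), Or.inl (by omega),
        fun i => ?_⟩
      rw [eTA_orb ho2, eTA_bd (by omega), inn]
      simp only [hmi]
      split_ifs with g1 g2
      · rfl
      · exfalso; apply g2; rw [← hs]; congr 1; omega
      · rfl
    · have ho2 : Orb (n + 1 : ℤ) (TA n A ⟨m, hmn⟩) (A j + 1) (A j + j + 2) := by
        convert ho' using 1 <;> omega
      refine ⟨A j + 1, by omega, by omega, Or.inl rfl, Or.inr (Or.inr ⟨_, ho2⟩),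
        fun i => ?_⟩
      rw [eTA_orb ho2, eTA_bd rfl, inn]
      simp only [hmi]
      split_ifs with g1 g2
      · exfalso
        have : (i : ℕ) = m := by omega
        rw [this] at g2; omega
      · rfl
      · rfl

theorem TA_outer (hA : Adm n A) (j : Fin n) : ∃ c, A j + j + 2 < c ∧ c < A j + 2 * (n + 1) ∧
    InT (n + 1 : ℤ) (TA n A) (A j + j + 2) c ∧
    InT (n + 1 : ℤ) (TA n A) c (A j + 2 * (n + 1)) ∧
    ∀ i : Fin n, eT (n + 1 : ℤ) (TA n A) i (A j + j + 2) c -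
      eT (n + 1 : ℤ) (TA n A) i c (A j + 2 * (n + 1)) = out n A i j := by
  by_cases hl : (j : ℕ) + 1 = n
  · obtain ⟨c, h1, h2, h3, h4, h5⟩ := TA_inner hA j
    have h0 := hA.last j hl
    have z1 : A j + j + 2 = A j + 1 * (n + 1) := by omega
    have z2 : A j + 2 * (n + 1) = A j + j + 2 + 1 * ((n : ℤ) + 1) := by omega
    refine ⟨c + 1 * (n + 1), by omega, by omega, ?_, ?_, fun i => ?_⟩
    · rw [z1]; exact h3.shift 1
    · rw [z2]; exact h4.shift 1
    · rw [z2, eT_shift]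
      rw [out, if_pos hl, ← h5, z1, eT_shift, ← z1]
  · have hmn : (j : ℕ) + 1 < n := by have := j.2; omega
    have hmi : ∀ i : Fin n, i = (⟨j + 1, hmn⟩ : Fin n) ↔ (i : ℕ) = j + 1 := by
      intro i; rw [Fin.ext_iff]
    have ho := orb_swap (orb_self (n + 1 : ℤ) (TA n A ⟨j + 1, hmn⟩))
    simp only [TA] at ho
    push_cast at ho
    have ho' : Orb (n + 1 : ℤ) (TA n A ⟨j + 1, hmn⟩) (A (j + 1) + (j + 1) + 2)
        (A (j + 1) + 2 * (n + 1)) := ho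
    rcases hA.step j hmn with hs | hs
    · have ho2 : Orb (n + 1 : ℤ) (TA n A ⟨j + 1, hmn⟩) (A j + j + 3) (A j + 2 * (n + 1)) := by
        convert ho' using 1 <;> omega
      refine ⟨A j + j + 3, by omega, by omega, Or.inl (by omega), Or.inr (Or.inr ⟨_, ho2⟩),
        fun i => ?_⟩
      rw [eTA_orb ho2, eTA_bd (by omega), out, if_neg hl]
      simp only [hmi]
      split_ifs with g1 g2
      · rfl
      · exfalso; apply g2; rw [hs, g1]
      · rfl
    · have ho2 : Orb (n + 1 : ℤ) (TA n A ⟨j + 1, hmn⟩) (A j + j + 2) (A j + 2 * (n + 1) - 1) := by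
        convert ho' using 1 <;> omega
      refine ⟨A j + 2 * (n + 1) - 1, by omega, by omega, Or.inr (Or.inr ⟨_, ho2⟩),
        Or.inl (by omega), fun i => ?_⟩
      rw [eTA_orb ho2, eTA_bd (by omega), out, if_neg hl]
      simp only [hmi]
      split_ifs with g1 g2
      · exfalso; rw [g1] at g2; omega
      · rfl
      · rfl

theorem TA_tri (hA : Adm n A) : Tri (n + 1 : ℤ) (TA n A) := by
  refine ⟨TA_len, fun i j x y h h' => TA_inj h h', TA_nc hA, ?_⟩
  intro i a b h
  obtain ⟨k, ⟨f1, f2⟩ | ⟨f1, f2⟩⟩ := TA_orb h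
  · obtain ⟨c, h1, h2, h3, h4, -⟩ := TA_inner hA i
    subst f1 f2
    exact ⟨c + k * (n + 1), by linarith, by linarith, h3.shift k, h4.shift k⟩
  · obtain ⟨c, h1, h2, h3, h4, -⟩ := TA_outer hA i
    have : A i + (k + 2) * (n + 1) = A i + 2 * (n + 1) + k * ((n : ℤ) + 1) := by ring
    rw [this] at f2
    subst f1 f2
    exact ⟨c + k * (n + 1), by linarith, by linarith, h3.shift k, h4.shift k⟩

theorem TA_realizes (hA : Adm n A) {B : Matrix (Fin n) (Fin n) ℤ}
    (hB : ∀ i j : Fin n, B i j = inn A i j + out n A i j) :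
    Realizes (n + 1 : ℤ) (TA n A) B := by
  apply realizes_of_base (TA_tri hA)
  intro j
  obtain ⟨r, h1, h2, h3, h4, h5⟩ := TA_inner hA j
  obtain ⟨s, g1, g2, g3, g4, g5⟩ := TA_outer hA j
  refine ⟨A j, r, A j + j + 2, s, ⟨orb_self _ _, h1, h2, g1, g2, h3, h4, g3, g4⟩, fun i => ?_⟩
  rw [hB, ← h5, ← g5]
  unfold colT
  ring

end initial

theorem mutMat_invol {n : ℕ} (k : Fin n) (B : Matrix (Fin n) (Fin n) ℤ) :
    mutMat k (mutMat k B) = B := by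
  funext i j
  by_cases h : i = k ∨ j = k
  · simp [mutMat, h]
  · have hi : i ≠ k := fun e => h (Or.inl e)
    have hj : j ≠ k := fun e => h (Or.inr e)
    simp [mutMat, hi, hj]

/-- Entrywise form of skew-symmetrizability. -/
theorem skew_iff {n : ℕ} (B : Matrix (Fin n) (Fin n) ℤ) : SkewSymmetrizable B ↔
    ∃ d : Fin n → ℤ, (∀ i, 0 < d i) ∧ ∀ i j, d i * B i j = -(d j * B j i) := by
  constructor
  · rintro ⟨d, hd, h⟩
    refine ⟨d, hd, fun i j => ?_⟩
    have := congrFun (congrFun h j) i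
    simpa [Matrix.diagonal_mul, Matrix.transpose_apply] using this
  · rintro ⟨d, hd, h⟩
    refine ⟨d, hd, ?_⟩
    funext j i
    simpa [Matrix.diagonal_mul, Matrix.transpose_apply] using h i j

theorem skew_mut {n : ℕ} (k : Fin n) (B : Matrix (Fin n) (Fin n) ℤ)
    (h : SkewSymmetrizable B) : SkewSymmetrizable (mutMat k B) := by
  rw [skew_iff] at h ⊢
  obtain ⟨d, hd, h⟩ := h
  refine ⟨d, hd, fun i j => ?_⟩
  have key : ∀ a b, d a * max (B a b) 0 = d b * max (-(B b a)) 0 := by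
    intro a b
    rw [mul_max_of_nonneg _ _ (hd a).le, mul_max_of_nonneg _ _ (hd b).le, h a b]
    simp
  have key' : ∀ a b, d a * max (-(B a b)) 0 = d b * max (B b a) 0 := fun a b => (key b a).symm
  by_cases hc : i = k ∨ j = k
  · have hc' : j = k ∨ i = k := hc.symm
    simp only [mutMat, hc, hc', if_true]
    have := h i j
    linarith
  · have hc' : ¬ (j = k ∨ i = k) := fun e => hc e.symm
    simp only [mutMat, hc, hc', if_false]
    rw [mut_formula, mut_formula]
    have h0 := h i j
    have e1 : d i * (max (B k j) 0 * max (B i k) 0) = d j * (max (-(B k i)) 0 * max (-(B j k)) 0) := by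
      calc _ = max (B k j) 0 * (d i * max (B i k) 0) := by ring
        _ = max (-(B k i)) 0 * (d k * max (B k j) 0) := by rw [key i k]; ring
        _ = _ := by rw [key k j]; ring
    have e2 : d i * (max (-(B k j)) 0 * max (-(B i k)) 0) = d j * (max (B k i) 0 * max (B j k) 0) := by
      calc _ = max (-(B k j)) 0 * (d i * max (-(B i k)) 0) := by ring
        _ = max (B k i) 0 * (d k * max (-(B k j)) 0) := by rw [key' i k]; ring
        _ = _ := by rw [key' k j]; ring
    linear_combination h0 + e1 - e2

theorem skew_seed {n : ℕ} {B : Matrix (Fin n) (Fin n) ℤ} (hB : SkewSymmetrizable B)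
    {s : Matrix (Fin n) (Fin n) ℤ × (Fin n → CAField n)} (hs : IsSeed B s) :
    SkewSymmetrizable s.1 := by
  induction hs with
  | refl => exact hB
  | tail _ h ih =>
    obtain ⟨k, rfl⟩ := h
    exact skew_mut k _ ih

section relabel
variable {n : ℕ} {M : ℤ} {T : Fin n → ℤ × ℤ}

theorem InT_relabel (e : Equiv.Perm (Fin n)) {a b : ℤ} :
    InT M (T ∘ e) a b ↔ InT M T a b := by
  unfold InT
  have : (∃ i, Orb M ((T ∘ e) i) a b) ↔ ∃ i, Orb M (T i) a b :=
    ⟨fun ⟨i, h⟩ => ⟨e i, h⟩, fun ⟨i, h⟩ => ⟨e.symm i, by simpa using h⟩⟩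
  rw [this]

theorem Tri.relabel (hT : Tri M T) (e : Equiv.Perm (Fin n)) : Tri M (T ∘ e) := by
  constructor
  · intro i; exact hT.len (e i)
  · intro i j x y h h'; exact e.injective (hT.inj _ _ _ _ h h')
  · intro a b c d h h'
    rw [InT_relabel] at h h'
    exact hT.nc a b c d h h'
  · intro i a b h
    obtain ⟨c, h1, h2, h3, h4⟩ := hT.third (e i) a b h
    exact ⟨c, h1, h2, (InT_relabel e).2 h3, (InT_relabel e).2 h4⟩

theorem Quad.relabel {e : Equiv.Perm (Fin n)} {k : Fin n} {p r q s : ℤ}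
    (h : Quad M (T ∘ e) k p r q s) : Quad M T (e k) p r q s := by
  obtain ⟨g0, g1, g2, g3, g4, g5, g6, g7, g8⟩ := h
  rw [InT_relabel] at g5 g6 g7 g8
  exact ⟨g0, g1, g2, g3, g4, g5, g6, g7, g8⟩

theorem Realizes.relabel {B : Matrix (Fin n) (Fin n) ℤ} (h : Realizes M T B)
    (e : Equiv.Perm (Fin n)) : Realizes M (T ∘ e) (fun i j => B (e i) (e j)) := by
  intro j p r q s hq i
  exact h (e j) p r q s hq.relabel (e i)

end relabel

/-- The base seed of Cartan type `C`. -/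
theorem base_realized {n : ℕ} (hn : 2 ≤ n) (b : Matrix (Fin n) (Fin n) ℤ)
    (hb : SkewSymmetrizable b) (hc : ∀ i j, cartanCounterpart b i j = cartanC n i j) :
    ∃ T, Tri (n + 1 : ℤ) T ∧ Realizes (n + 1 : ℤ) T b := by
  classical
  rw [skew_iff] at hb
  obtain ⟨d, hd, hs⟩ := hb
  have hdiag : ∀ i, b i i = 0 := by
    intro i
    have h1 := hs i i
    have h2 := hd i
    nlinarith [sq_nonneg (b i i)]
  have hpos : ∀ i j, 0 < b i j ↔ b j i < 0 := by
    intro i j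
    have h1 := hs i j
    have h2 := hd i
    have h3 := hd j
    constructor
    · intro h; nlinarith [mul_pos h2 h]
    · intro h; nlinarith [mul_pos h3 (neg_pos.2 h)]
  have habs : ∀ i j : Fin n, i ≠ j → |b i j| =
      if i.val + 2 = n ∧ j.val + 1 = n then 2
      else if i.val + 1 = j.val ∨ j.val + 1 = i.val then 1 else 0 := by
    intro i j hij
    have := hc i j
    simp only [cartanCounterpart, cartanC, hij, if_false] at this
    split_ifs at this ⊢ <;> linarith
  let η : ℕ → ℤ := fun k => if h : k + 1 < n then
    (if 0 < b ⟨k, by omega⟩ ⟨k + 1, h⟩ then 0 else 1) else 0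
  let A : ℕ → ℤ := fun i => ∑ k ∈ Finset.Ico i (n - 1), η k
  have hstep : ∀ i, i + 1 < n → A i = A (i + 1) + η i := by
    intro i hi
    have := Finset.sum_eq_sum_Ico_succ_bot (show i < n - 1 by omega) η
    simp only [A]
    linarith
  have hη : ∀ i (h : i + 1 < n), η i = if 0 < b ⟨i, by omega⟩ ⟨i + 1, h⟩ then 0 else 1 := by
    intro i h; simp only [η, h, dif_pos]
  have hA : Adm n A := by
    refine ⟨hn, fun i hi => ?_, fun i hi => ?_⟩
    · have h1 := hstep i hi
      have h2 := hη i hi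
      split_ifs at h2 <;> omega
    · simp only [A]
      have : n - 1 = i := by omega
      simp [this]
  have hAiff : ∀ i (h : i + 1 < n), A i = A (i + 1) ↔ 0 < b ⟨i, by omega⟩ ⟨i + 1, h⟩ := by
    intro i h
    have h1 := hstep i h
    have h2 := hη i h
    split_ifs at h2 with h3
    · simp only [h3, iff_true]; omega
    · simp only [h3, iff_false]; omega
  refine ⟨TA n A, TA_tri hA, TA_realizes hA ?_⟩
  intro i j
  by_cases hij : i = j
  · subst hij
    rw [hdiag]
    simp only [inn, out]
    have h1 : ¬ (i.val + 1 = i.val) := by omega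
    have h2 : ¬ (i.val = i.val + 1) := by omega
    simp
  have h0 := habs i j hij
  by_cases h1 : i.val + 1 = j.val
  · have h2 := hAiff i.val (by omega)
    have e1 : (⟨i.val + 1, by omega⟩ : Fin n) = j := Fin.ext h1
    have e2 : (⟨i.val, by omega⟩ : Fin n) = i := rfl
    rw [e1, e2, h1] at h2
    have h3 : ¬ (i.val = j.val + 1) := by omega
    simp only [inn, out, h1, h2, h3, if_true, if_false]
    by_cases h4 : j.val + 1 = n
    · have h5 : i.val + 2 = n := by omega
      simp only [h4, h5, and_self, if_true] at h0 ⊢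
      rcases abs_cases (b i j) with ⟨h6, h7⟩ | ⟨h6, h7⟩ <;> split_ifs <;> omega
    · simp only [h4, and_false, h1, true_or, if_true, if_false] at h0 ⊢
      rcases abs_cases (b i j) with ⟨h6, h7⟩ | ⟨h6, h7⟩ <;> split_ifs <;> omega
  by_cases h2 : i.val = j.val + 1
  · have h3 := hAiff j.val (by omega)
    have e1 : (⟨j.val + 1, by omega⟩ : Fin n) = i := Fin.ext h2.symm
    have e2 : (⟨j.val, by omega⟩ : Fin n) = j := rfl
    rw [e1, e2, ← h2, hpos] at h3
    have h4 : ¬ (j.val + 1 = n) := by omega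
    have h5 : j.val + 1 = i.val := h2.symm
    simp only [inn, out, h1, h2.symm, h3, if_true, if_false]
    simp only [h5, or_true, if_true] at h0 ⊢
    have h6 : ¬ (i.val = n) := by omega
    simp only [h6, if_false]
    rcases abs_cases (b i j) with ⟨h6, h7⟩ | ⟨h6, h7⟩ <;> split_ifs <;> omega
  · have h3 : ¬ (i.val + 2 = n ∧ j.val + 1 = n) := by omega
    have h4 : ¬ (i.val + 1 = j.val ∨ j.val + 1 = i.val) := by omega
    rw [if_neg h3, if_neg h4, abs_eq_zero] at h0
    simp [inn, out, h0, h1, h2]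

theorem realizes_back {n : ℕ} {B : Matrix (Fin n) (Fin n) ℤ}
    {s : Matrix (Fin n) (Fin n) ℤ × (Fin n → CAField n)} (hs : IsSeed B s)
    {M : ℤ} (hM : 0 < M) (h : ∃ T, Tri M T ∧ Realizes M T s.1) :
    ∃ T, Tri M T ∧ Realizes M T B := by
  induction hs with
  | refl => exact h
  | tail _ h' ih =>
    obtain ⟨k, rfl⟩ := h'
    obtain ⟨T, hT, hR⟩ := h
    apply ih
    obtain ⟨r, s, hq⟩ := hT.exists_quad (orb_self M (T k))
    refine ⟨flipT T k r s, hT.flip hM hq, ?_⟩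
    have := hR.flip hM hT hq
    simpa only [mutSeed, mutMat_invol] using this

theorem pattern_realized {n : ℕ} (hn : 2 ≤ n) {B : Matrix (Fin n) (Fin n) ℤ}
    (hB : SkewSymmetrizable B) (htype : PatternOfType (cartanC n) B) :
    ∃ T, Tri (n + 1 : ℤ) T ∧ Realizes (n + 1 : ℤ) T B := by
  obtain ⟨s, hs, σ, hσ⟩ := htype
  refine realizes_back hs (by positivity) ?_
  have h1 := skew_seed hB hs
  obtain ⟨T, hT, hR⟩ := base_realized hn (fun i j => s.1 (σ i) (σ j)) (by
    obtain ⟨d, hd, h⟩ := (skew_iff _).1 h1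
    exact (skew_iff _).2 ⟨d ∘ σ, fun i => hd _, fun i j => h _ _⟩) (by
    intro i j
    rw [← hσ i j]
    simp [cartanCounterpart])
  refine ⟨T ∘ σ.symm, hT.relabel _, ?_⟩
  have := hR.relabel σ.symm
  simpa using this

theorem sum_eT {n : ℕ} {M : ℤ} (hM : 1 < M) {T T0 : Fin n → ℤ × ℤ} (hT : Tri M T)
    (hT0 : Tri M T0) (l : Fin n) {x y : ℤ} (hx : InT M T x y) :
    ∑ i, eT M T i x y * Enum M (T0 l) (T i).1 (T i).2 = Enum M (T0 l) x y := by
  have hb : (y = x + 1 ∨ y = x + 2 * M - 1) →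
      ∑ i, eT M T i x y * Enum M (T0 l) (T i).1 (T i).2 = Enum M (T0 l) x y := by
    intro h
    rw [Enum_boundary hM hT0 h]
    refine Finset.sum_eq_zero fun i _ => ?_
    rw [eT_neg, zero_mul]
    intro ho
    have := hT.orb_lt ho
    omega
  rcases hx with h | h | ⟨j, h⟩
  · exact hb (Or.inl h)
  · exact hb (Or.inr h)
  · rw [Finset.sum_eq_single j]
    · have hl := hT.len j
      rw [eT_pos h, one_mul, Enum_orb (by omega) (T0 l) (T j) (by omega) (by omega) h]
    · intro i _ hij
      rw [eT_neg, zero_mul]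
      intro ho
      exact hij (hT.inj _ _ _ _ ho h)
    · intro h; exact absurd (Finset.mem_univ j) h

/-- Only the zero functional kills all arcs of `T` and all common arcs. -/
def QInd {n : ℕ} (M : ℤ) (T0 T : Fin n → ℤ × ℤ) : Prop :=
  ∀ w : Fin n → ℚ, (∀ j, ∑ l, w l * (Enum M (T0 l) (T j).1 (T j).2 : ℚ) = 0) →
    (∀ j l, Orb M (T0 l) (T j).1 (T j).2 → w l = 0) → w = 0

theorem good_of_InT {n : ℕ} {M : ℤ} (hM : 1 < M) {T T0 : Fin n → ℤ × ℤ} (hT : Tri M T)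
    (hT0 : Tri M T0) {w : Fin n → ℚ}
    (h1 : ∀ j, ∑ l, w l * (Enum M (T0 l) (T j).1 (T j).2 : ℚ) = 0)
    (h2 : ∀ j l, Orb M (T0 l) (T j).1 (T j).2 → w l = 0) {x y : ℤ} (hx : InT M T x y) :
    (∑ l, w l * (Enum M (T0 l) x y : ℚ) = 0) ∧ ∀ l, Orb M (T0 l) x y → w l = 0 := by
  have hb : (y = x + 1 ∨ y = x + 2 * M - 1) →
      (∑ l, w l * (Enum M (T0 l) x y : ℚ) = 0) ∧ ∀ l, Orb M (T0 l) x y → w l = 0 := by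
    intro h
    constructor
    · refine Finset.sum_eq_zero fun i _ => ?_
      rw [Enum_boundary hM hT0 h]; simp
    · intro l ho
      have := hT0.orb_lt ho
      omega
  rcases hx with h | h | ⟨j, h⟩
  · exact hb (Or.inl h)
  · exact hb (Or.inr h)
  · have hl := hT.len j
    constructor
    · rw [← h1 j]
      refine Finset.sum_congr rfl fun l _ => ?_
      rw [Enum_orb (by omega) (T0 l) (T j) (by omega) (by omega) h]
    · intro l ho
      exact h2 j l (orb_trans ho (orb_symm h))

theorem QInd.flip {n : ℕ} {M : ℤ} (hM : 1 < M) {T T0 : Fin n → ℤ × ℤ} (hT : Tri M T)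
    (hT0 : Tri M T0) {k : Fin n} {p r q s : ℤ} (h : Quad M T k p r q s)
    (hQ : QInd M T0 T) : QInd M T0 (flipT T k r s) := by
  have hM0 : 0 < M := by omega
  intro w h1 h2
  have hT' := hT.flip hM0 h
  have hq := h.flip hM0 hT h
  have good : ∀ x y, InT M (flipT T k r s) x y → _ :=
    fun x y hx => good_of_InT hM hT' hT0 h1 h2 hx
  have hF := F_lemma hM0 hT0 hq.pr hq.rq hq.qs hq.sp (w := w) (by
    rintro x y (⟨rfl, rfl⟩ | ⟨rfl, rfl⟩ | ⟨rfl, rfl⟩ | ⟨rfl, rfl⟩ | ⟨rfl, rfl⟩)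
    · exact good _ _ hq.ipr
    · exact good _ _ hq.irq
    · exact good _ _ hq.iqs
    · exact good _ _ hq.isp.swap'
    · exact good _ _ (Or.inr (Or.inr ⟨k, hq.diag⟩)))
  have ho : Orb M (T k) q (p + 2 * M) := orb_swap h.diag
  have hl := hT.len k
  apply hQ w
  · intro j
    by_cases hj : j = k
    · subst hj
      rw [← hF.1]
      refine Finset.sum_congr rfl fun l _ => ?_
      rw [Enum_orb hM0 (T0 l) (T j) (by omega) (by omega) ho]
    · have := h1 j
      rwa [flip_ne hj] at this
  · intro j l
    by_cases hj : j = k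
    · subst hj
      intro h3
      exact hF.2 l (orb_trans h3 ho)
    · have := h2 j l
      rwa [flip_ne hj] at this

theorem Enum_self {n : ℕ} {M : ℤ} (hM : 0 < M) {T0 : Fin n → ℤ × ℤ}
    (hT0 : Tri M T0) (l j : Fin n) :
    Enum M (T0 l) (T0 j).1 (T0 j).2 =
      (-Enum M (T0 l) (T0 l).1 (T0 l).2) * (if l = j then -1 else 0) := by
  by_cases h : l = j
  · subst h; simp
  · simp only [h, if_false, mul_zero]
    have hl := hT0.len j
    refine (Enum_nc hM hT0 (Or.inr (Or.inr ⟨j, orb_self M _⟩)) (by omega) (by omega)).2 ?_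
    intro ho
    exact h (hT0.inj _ _ _ _ ho (orb_self M _))

theorem Enum_self_pos {n : ℕ} {M : ℤ} (hM : 0 < M) {T0 : Fin n → ℤ × ℤ}
    (hT0 : Tri M T0) (l : Fin n) : 0 < -Enum M (T0 l) (T0 l).1 (T0 l).2 := by
  have hl := hT0.len l
  have := (Enum_nc (l := l) hM hT0 (Or.inr (Or.inr ⟨l, orb_self M _⟩)) (by omega) (by omega)).1
    (orb_self M _)
  omega

/-- The invariant: seeds correspond to triangulations, denominators to crossing numbers. -/
def SeedInv {n : ℕ} (M : ℤ) (T0 : Fin n → ℤ × ℤ)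
    (s : Matrix (Fin n) (Fin n) ℤ × (Fin n → CAField n)) : Prop :=
  ∃ T, Tri M T ∧ Realizes M T s.1 ∧ QInd M T0 T ∧ ∃ D : Fin n → Fin n → ℤ,
    (∀ j, Trop (s.2 j) (D j)) ∧
    ∀ l j, Enum M (T0 l) (T j).1 (T j).2 = (-Enum M (T0 l) (T0 l).1 (T0 l).2) * D j l

theorem SeedInv.base {n : ℕ} {M : ℤ} (hM : 1 < M) {T0 : Fin n → ℤ × ℤ} (hT0 : Tri M T0)
    {B : Matrix (Fin n) (Fin n) ℤ} (hB : Realizes M T0 B) :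
    SeedInv M T0 (B, uVar n) := by
  refine ⟨T0, hT0, hB, ?_, fun j i => if i = j then -1 else 0, fun j => Trop_uVar j,
    fun l j => Enum_self (by omega) hT0 l j⟩
  intro w _ h2
  funext l
  exact h2 l l (orb_self M _)

theorem SeedInv.step {n : ℕ} {M : ℤ} (hM : 1 < M) {T0 : Fin n → ℤ × ℤ} (hT0 : Tri M T0)
    {s : Matrix (Fin n) (Fin n) ℤ × (Fin n → CAField n)} (h : SeedInv M T0 s) (k : Fin n) :
    SeedInv M T0 (mutSeed k s) := by
  have hM0 : 0 < M := by omega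
  obtain ⟨T, hT, hR, hQ, D, hD, hE⟩ := h
  obtain ⟨r, t, hq⟩ := hT.exists_quad (orb_self M (T k))
  have hP := Trop_prod hD (fun i => (s.1 i k).toNat) Finset.univ
  have hN := Trop_prod hD (fun i => (-(s.1 i k)).toNat) Finset.univ
  have hnew := (hP.add hN).div (hD k)
  refine ⟨flipT T k r t, hT.flip hM0 hq, hR.flip hM0 hT hq, hQ.flip hM hT hT0 hq,
    Function.update D k ((fun i => max (∑ j, ((s.1 j k).toNat : ℤ) * D j i)
      (∑ j, ((-s.1 j k).toNat : ℤ) * D j i)) - D k), ?_, ?_⟩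
  · intro j
    by_cases hj : j = k
    · subst hj
      simp only [mutSeed, Function.update_self]
      exact hnew
    · simp only [mutSeed, Function.update_of_ne hj]
      exact hD j
  · intro l j
    by_cases hj : j = k
    · subst hj
      rw [flip_k, Function.update_self]
      simp only [Pi.sub_apply]
      have hm := Enum_self_pos hM0 hT0 l
      have hl0 := hT0.len l
      have htr := Enum_tropical hM0 (T0 l) (by omega) (by omega) hq.pr hq.rq hq.qs hq.sp
      have e1 : Enum M (T0 l) (T j).1 r + Enum M (T0 l) (T j).2 t =
          (-Enum M (T0 l) (T0 l).1 (T0 l).2) * ∑ i, ((s.1 i j).toNat : ℤ) * D i l := by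
        rw [← sum_eT hM hT hT0 l hq.ipr, ← sum_eT hM hT hT0 l hq.iqs, ← Finset.sum_add_distrib,
          Finset.mul_sum]
        refine Finset.sum_congr rfl fun i _ => ?_
        rw [Int.toNat_eq_max, hR j _ _ _ _ hq i, (col_parts hM0 T i hq.pr hq.rq hq.qs hq.sp).1,
          hE l i]
        ring
      have e2 : Enum M (T0 l) r (T j).2 + Enum M (T0 l) t ((T j).1 + 2 * M) =
          (-Enum M (T0 l) (T0 l).1 (T0 l).2) * ∑ i, ((-(s.1 i j)).toNat : ℤ) * D i l := by
        rw [← sum_eT hM hT hT0 l hq.irq, ← sum_eT hM hT hT0 l hq.isp, ← Finset.sum_add_distrib,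
          Finset.mul_sum]
        refine Finset.sum_congr rfl fun i _ => ?_
        rw [Int.toNat_eq_max, hR j _ _ _ _ hq i, (col_parts hM0 T i hq.pr hq.rq hq.qs hq.sp).2,
          hE l i]
        ring
      rw [e1, e2, ← mul_max_of_nonneg _ _ hm.le, hE l j] at htr
      rw [mul_sub]
      linarith
    · rw [flip_ne hj, Function.update_of_ne hj]
      exact hE l j

theorem SeedInv.of_seed {n : ℕ} {M : ℤ} (hM : 1 < M) {T0 : Fin n → ℤ × ℤ} (hT0 : Tri M T0)
    {B : Matrix (Fin n) (Fin n) ℤ} (hB : Realizes M T0 B)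
    {s : Matrix (Fin n) (Fin n) ℤ × (Fin n → CAField n)} (hs : IsSeed B s) :
    SeedInv M T0 s := by
  induction hs with
  | refl => exact SeedInv.base hM hT0 hB
  | tail _ h ih =>
    obtain ⟨k, rfl⟩ := h
    exact ih.step hM hT0 k

theorem SeedInv.indep {n : ℕ} {M : ℤ} (hM : 1 < M) {T0 : Fin n → ℤ × ℤ} (hT0 : Tri M T0)
    {s : Matrix (Fin n) (Fin n) ℤ × (Fin n → CAField n)} (h : SeedInv M T0 s)
    (d : Fin n → Fin n → ℤ) (hd : ∀ j, IsDenomVec (uVar n) (s.2 j) (d j)) :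
    LinearIndependent ℚ (fun j : Fin n => fun i : Fin n => (d j i : ℚ)) := by
  have hM0 : 0 < M := by omega
  obtain ⟨T, hT, hR, hQ, D, hD, hE⟩ := h
  obtain rfl : d = D := funext fun j => (hD j).denom (hd j)
  have key : ∀ w : Fin n → ℚ, (∀ j, ∑ l, (d j l : ℚ) * w l = 0) → w = 0 := by
    intro w hw
    have hm : ∀ l, ((-Enum M (T0 l) (T0 l).1 (T0 l).2 : ℤ) : ℚ) ≠ 0 := fun l => by
      have := Enum_self_pos hM0 hT0 l
      exact_mod_cast this.ne'
    have h0 := hQ (fun l => w l / ((-Enum M (T0 l) (T0 l).1 (T0 l).2 : ℤ) : ℚ)) (by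
      intro j
      rw [← hw j]
      refine Finset.sum_congr rfl fun l _ => ?_
      rw [hE l j, Int.cast_mul, div_mul_eq_mul_div, mul_comm (w l), mul_assoc,
        mul_div_assoc, mul_comm, div_mul_cancel₀ _ (hm l)]) (by
      intro j l ho
      have hl0 := hT0.len l
      have hdj : ∀ i, d j i = if i = l then -1 else 0 := by
        intro i
        have h1 := hE i j
        rw [Enum_orb hM0 (T0 i) (T0 l) (by omega) (by omega) ho, Enum_self hM0 hT0 i l] at h1
        exact (mul_left_cancel₀ (Enum_self_pos hM0 hT0 i).ne' h1).symm
      have h2 := hw j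
      simp only [hdj] at h2
      simp at h2
      simp [h2])
    funext l
    have := congrFun h0 l
    simp only [Pi.zero_apply, div_eq_zero_iff] at this
    exact this.resolve_right (hm l)
  let A : Matrix (Fin n) (Fin n) ℚ := fun j i => (d j i : ℚ)
  have hdet : A.det ≠ 0 := by
    intro hdet
    obtain ⟨v, hv, hv'⟩ := Matrix.exists_mulVec_eq_zero_iff.2 hdet
    exact hv (key v fun j => congrFun hv' j)
  exact Matrix.linearIndependent_rows_iff_isUnit.2
    ((Matrix.isUnit_iff_isUnit_det A).2 (isUnit_iff_ne_zero.2 hdet))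


theorem denominators_linearly_independent_type_C {n : ℕ} (hn : 2 ≤ n)
    (B : Matrix (Fin n) (Fin n) ℤ) (hB : SkewSymmetrizable B)
    (htype : PatternOfType (cartanC n) B)
    (s : Matrix (Fin n) (Fin n) ℤ × (Fin n → CAField n)) (hs : IsSeed B s)
    (d : Fin n → Fin n → ℤ) (hd : ∀ j, IsDenomVec (uVar n) (s.2 j) (d j)) :
    LinearIndependent ℚ (fun j : Fin n => fun i : Fin n => (d j i : ℚ)) := by
  
  have hM : (1 : ℤ) < n + 1 := by omega
  obtain ⟨T0, hT0, hR⟩ := pattern_realized hn hB htype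
  exact (SeedInv.of_seed hM hT0 hR hs).indep hM hT0 d hd
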